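/- For any ε>0 and g>1, the system of ordinary differential equations d⁴A/dx⁴ = A(1−|A|²−g|B|²), d²B/dx² = ε²B(−1+g|A|²+|B|²) possesses a smooth real-valued solution (A_{ε,g},B_{ε,g}) : ℝ → ℝ² with the following properties: (1) lim_{x→−∞}(A_{ε,g}(x),B_{ε,g}(x)) = (1,0) and lim_{x→+∞}(A_{ε,g}(x),B_{ε,g}(x)) = (0,1); (2) B_{ε,g}(x) ≥ 0 for all x ∈ ℝ; (3) for each fixed ε>0 the family of solutions can be chosen so that lim_{g→1⁺} sup_{x∈ℝ} |A_{ε,g}(x)² + B_{ε,g}(x)² − 1| = 0. -/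

import Mathlib

section Helpers

open MeasureTheory Filter Topology Set

/-! ### Primitives -/

/-- `F` is a primitive of the locally integrable function `f`. -/
def Prim (F f : ℝ → ℝ) : Prop :=
  LocallyIntegrable f volume ∧ ∀ x y, F y - F x = ∫ t in x..y, f t

namespace Prim

variable {F f G h : ℝ → ℝ}

theorem intble (H : Prim F f) (x y : ℝ) : IntervalIntegrable f volume x y :=
  (H.1.integrableOn_isCompact isCompact_uIcc).intervalIntegrable

theorem cont (H : Prim F f) : Continuous F := by
  have h1 : F = fun y => F 0 + ∫ t in (0:ℝ)..y, f t := by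
    funext y
    have := H.2 0 y
    linarith
  rw [h1]
  exact continuous_const.add
    (intervalIntegral.continuous_primitive (fun a b => H.intble a b) 0)

theorem of_base (hf : LocallyIntegrable f volume) (c : ℝ)
    (h : ∀ y, F y - F c = ∫ t in c..y, f t) : Prim F f := by
  refine ⟨hf, fun x y => ?_⟩
  have hi : ∀ x y : ℝ, IntervalIntegrable f volume x y := fun x y =>
    (hf.integrableOn_isCompact isCompact_uIcc).intervalIntegrable
  have h1 := intervalIntegral.integral_add_adjacent_intervals (hi c x) (hi x y)
  have h2 := h x
  have h3 := h y
  linarith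

theorem of_hasDerivAt (hc : Continuous f) (h : ∀ x, HasDerivAt F (f x) x) : Prim F f := by
  refine ⟨hc.locallyIntegrable, fun x y => ?_⟩
  rw [intervalIntegral.integral_eq_sub_of_hasDerivAt (fun x _ => h x)
    (hc.intervalIntegrable _ _)]

theorem hasDerivAt (H : Prim F f) (hc : Continuous f) (x : ℝ) : HasDerivAt F (f x) x := by
  have h1 : F = fun y => F 0 + ∫ t in (0:ℝ)..y, f t := by
    funext y
    have := H.2 0 y
    linarith
  rw [h1]
  exact (hc.integral_hasStrictDerivAt 0 x).hasDerivAt.const_add _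

theorem congr_ae (H : Prim F f) (hfh : f =ᵐ[volume] h) : Prim F h := by
  refine ⟨?_, fun x y => ?_⟩
  · exact H.1.congr hfh
  · rw [H.2 x y]
    exact intervalIntegral.integral_congr_ae (hfh.mono fun t ht _ => ht)

theorem add (H : Prim F f) (K : Prim G h) : Prim (fun x => F x + G x) (fun x => f x + h x) := by
  refine ⟨H.1.add K.1, fun x y => ?_⟩
  rw [intervalIntegral.integral_add (H.intble x y) (K.intble x y), ← H.2, ← K.2]
  ring

theorem smul (c : ℝ) (H : Prim F f) : Prim (fun x => c * F x) (fun x => c * f x) := by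
  refine ⟨H.1.smul c, fun x y => ?_⟩
  rw [intervalIntegral.integral_const_mul, ← H.2]
  ring

theorem neg (H : Prim F f) : Prim (fun x => - F x) (fun x => - f x) := by
  refine ⟨H.1.neg, fun x y => ?_⟩
  rw [intervalIntegral.integral_neg, ← H.2]
  ring

theorem loc_of_intervalIntegrable (hi : ∀ x y : ℝ, IntervalIntegrable f volume x y) :
    LocallyIntegrable f volume := by
  intro x
  refine ⟨Ioo (x-1) (x+1), Ioo_mem_nhds (by linarith) (by linarith), ?_⟩
  have := (hi (x-1) (x+1)).1
  exact this.mono_set Ioo_subset_Ioc_self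

theorem shift (H : Prim F f) (c : ℝ) : Prim (fun x => F (x + c)) (fun x => f (x + c)) := by
  refine ⟨loc_of_intervalIntegrable fun x y => ?_, fun x y => ?_⟩
  · have := (H.intble (x + c) (y + c)).comp_add_right c
    simpa using this
  · rw [intervalIntegral.integral_comp_add_right, H.2]

theorem refl (H : Prim F f) : Prim (fun x => F (-x)) (fun x => - f (-x)) := by
  refine ⟨loc_of_intervalIntegrable fun x y => ?_, fun x y => ?_⟩
  · have := (H.intble (-x) (-y)).comp_sub_left 0
    simp only [zero_sub, sub_zero, neg_neg] at this
    exact this.neg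
  · rw [intervalIntegral.integral_neg, intervalIntegral.integral_comp_neg, H.2,
      intervalIntegral.integral_symm]

theorem glue (H : Prim F f) (K : Prim G h) (c : ℝ) (e : F c = G c) :
    Prim (fun x => if x ≤ c then F x else G x) (fun x => if x ≤ c then f x else h x) := by
  have hi : ∀ x y : ℝ, IntervalIntegrable (fun x => if x ≤ c then f x else h x) volume x y := by
    intro x y
    constructor
    all_goals
      exact Integrable.piecewise (s := Iic c) measurableSet_Iic
        (by first | exact (H.intble x y).1.integrableOn | exact (H.intble x y).2.integrableOn)
        (by first | exact (K.intble x y).1.integrableOn | exact (K.intble x y).2.integrableOn)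
  refine of_base (loc_of_intervalIntegrable hi) c fun y => ?_
  rcases le_or_gt y c with hy | hy
  · simp only [hy, le_refl, if_true]
    rw [H.2]
    apply intervalIntegral.integral_congr_ae
    refine Eventually.of_forall fun t ht => ?_
    rw [uIoc_of_ge hy] at ht
    simp [ht.2]
  · simp only [not_le.2 hy, le_refl, if_true, if_false]
    rw [e, K.2]
    apply intervalIntegral.integral_congr_ae
    refine Eventually.of_forall fun t ht => ?_
    rw [uIoc_of_le hy.le] at ht
    simp [not_le.2 ht.1]

/-- Hölder-type estimate with a free parameter. -/
theorem young (H : Prim F f) (h2 : Integrable (fun x => f x ^ 2)) {l : ℝ} (hl : 0 < l)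
    (x y : ℝ) : |F y - F x| ≤ l / 2 * (∫ t, f t ^ 2) + |y - x| / (2 * l) := by
  rw [H.2 x y]
  have key : ∀ s : Set ℝ, s ⊆ univ → (volume s ≠ ⊤) → IntegrableOn f s →
      ∫ t in s, |f t| ≤ l / 2 * (∫ t, f t ^ 2) + volume.real s / (2 * l) := by
    intro s _ hs hf
    have h3 : ∫ t in s, |f t| ≤ ∫ t in s, (l / 2 * f t ^ 2 + 1 / (2 * l)) := by
      apply integral_mono hf.abs
      · exact (h2.integrableOn.const_mul _).add (integrableOn_const hs)
      · intro t
        have : |f t| ≤ l / 2 * |f t| ^ 2 + 1 / (2 * l) := by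
          have e1 : l / 2 * |f t| ^ 2 + 1 / (2 * l) - |f t| = (l * |f t| - 1) ^ 2 / (2 * l) := by
            field_simp
            ring
          have : 0 ≤ (l * |f t| - 1) ^ 2 / (2 * l) := by positivity
          linarith
        simpa [sq_abs] using this
    refine h3.trans ?_
    rw [integral_add (h2.integrableOn.const_mul _) (integrableOn_const hs), integral_const_mul,
      setIntegral_const]
    have h4 : ∫ t in s, f t ^ 2 ≤ ∫ t, f t ^ 2 :=
      setIntegral_le_integral h2 (Eventually.of_forall fun t => sq_nonneg _)
    have : l / 2 * ∫ t in s, f t ^ 2 ≤ l / 2 * ∫ t, f t ^ 2 := by gcongr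
    have e : volume.real s • (1 / (2 * l)) = volume.real s / (2 * l) := by
      simp [div_eq_mul_inv]
    rw [e]
    linarith
  have h0 : |∫ t in x..y, f t| ≤ ∫ t in uIoc x y, |f t| :=
    intervalIntegral.norm_integral_le_integral_norm_uIoc (f := f) (μ := volume)
  refine h0.trans ?_
  have := key (uIoc x y) (subset_univ _) (by rw [Set.uIoc]; simp)
    ((intervalIntegrable_iff).1 (H.intble x y))
  have e : volume.real (uIoc x y) = |y - x| := by
    rw [Set.uIoc, Measure.real, Real.volume_Ioc, ENNReal.toReal_ofReal (by simp), max_sub_min_eq_abs]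
  rw [e] at this
  exact this

theorem holder (H : Prim F f) (h2 : Integrable (fun x => f x ^ 2)) (x y : ℝ) :
    |F y - F x| ≤ ((∫ t, f t ^ 2) + 1) / 2 * √|y - x| := by
  rcases eq_or_ne x y with rfl | hne
  · simp
  have hp : 0 < |y - x| := abs_pos.2 (sub_ne_zero.2 hne.symm)
  have hs : 0 < √|y - x| := Real.sqrt_pos.2 hp
  have := H.young h2 hs x y
  have e : |y - x| / (2 * √|y - x|) = √|y - x| / 2 := by
    have e2 := Real.mul_self_sqrt hp.le
    field_simp
    nlinarith
  rw [e] at this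
  linarith

end Prim

instance sepL2 : TopologicalSpace.SeparableSpace (Lp ℝ 2 (volume : Measure ℝ)) := by
  have : Fact ((2 : ENNReal) ≠ ⊤) := ⟨by simp⟩
  infer_instance



/-! ### Paths and energy -/

/-- The potential. -/
noncomputable def Wp (g a b : ℝ) : ℝ := (a ^ 2 + b ^ 2 - 1) ^ 2 / 4 + (g - 1) / 2 * (a ^ 2 * b ^ 2)

theorem Wp_nonneg {g : ℝ} (hg : 1 ≤ g) (a b : ℝ) : 0 ≤ Wp g a b := by
  unfold Wp
  have : 0 ≤ g - 1 := by linarith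
  positivity

theorem sq_le_Wp {g : ℝ} (hg : 1 ≤ g) (a b : ℝ) : a ^ 2 + b ^ 2 ≤ 4 * Wp g a b + 2 := by
  unfold Wp
  have h1 : 0 ≤ g - 1 := by linarith
  have : 0 ≤ (g - 1) / 2 * (a ^ 2 * b ^ 2) := by positivity
  nlinarith [sq_nonneg (a ^ 2 + b ^ 2 - 1 - 1)]

theorem Wp_cont (g : ℝ) : Continuous fun z : ℝ × ℝ => Wp g z.1 z.2 := by
  unfold Wp
  fun_prop

/-- A path with its (weak) derivatives. -/
structure Pth where
  A : ℝ → ℝ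
  A1 : ℝ → ℝ
  u : ℝ → ℝ
  B : ℝ → ℝ
  v : ℝ → ℝ

/-- Energy density. -/
noncomputable def Pth.dens (p : Pth) (k g : ℝ) (x : ℝ) : ℝ :=
  p.u x ^ 2 / 2 + k * p.v x ^ 2 + Wp g (p.A x) (p.B x)

/-- Energy. -/
noncomputable def Pth.J (p : Pth) (k g : ℝ) : ℝ := ∫ x, p.dens k g x

/-- Admissible (finite energy) path. -/
structure Adm (g : ℝ) (p : Pth) : Prop where
  hA : Prim p.A p.A1
  hA1 : Prim p.A1 p.u
  hB : Prim p.B p.v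
  hu : Integrable fun x => p.u x ^ 2
  hv : Integrable fun x => p.v x ^ 2
  hW : Integrable fun x => Wp g (p.A x) (p.B x)

namespace Adm

variable {k g K : ℝ} {p : Pth}

theorem dens_int (H : Adm g p) (k : ℝ) : Integrable (p.dens k g) :=
  ((H.hu.div_const 2).add (H.hv.const_mul k)).add H.hW

theorem J_eq (H : Adm g p) (k : ℝ) : p.J k g =
    (∫ x, p.u x ^ 2) / 2 + k * (∫ x, p.v x ^ 2) + ∫ x, Wp g (p.A x) (p.B x) := by
  unfold Pth.J Pth.dens
  have h1 : Integrable fun x => p.u x ^ 2 / 2 + k * p.v x ^ 2 :=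
    (H.hu.div_const 2).add (H.hv.const_mul k)
  rw [integral_add h1 H.hW,
    integral_add (H.hu.div_const 2) (H.hv.const_mul k), integral_div, integral_const_mul]

theorem parts_le (H : Adm g p) (hk : 0 < k) (hg : 1 ≤ g) (hK : p.J k g ≤ K) :
    (∫ x, p.u x ^ 2) ≤ 2 * K ∧ (∫ x, p.v x ^ 2) ≤ K / k ∧
      (∫ x, Wp g (p.A x) (p.B x)) ≤ K ∧ 0 ≤ K := by
  rw [H.J_eq] at hK
  have h1 : 0 ≤ ∫ x, p.u x ^ 2 := integral_nonneg fun x => sq_nonneg _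
  have h2 : 0 ≤ ∫ x, p.v x ^ 2 := integral_nonneg fun x => sq_nonneg _
  have h3 : 0 ≤ ∫ x, Wp g (p.A x) (p.B x) := integral_nonneg fun x => Wp_nonneg hg _ _
  have h4 : 0 ≤ k * ∫ x, p.v x ^ 2 := by positivity
  refine ⟨by linarith, ?_, by linarith, by linarith⟩
  rw [le_div_iff₀ hk]
  linarith

theorem Wcont (H : Adm g p) : Continuous fun x => Wp g (p.A x) (p.B x) := by
  have h1 := H.hA.cont
  have h2 := H.hB.cont
  unfold Wp
  fun_prop

end Adm

theorem interval_le_integral {f : ℝ → ℝ} (hf : Integrable f) (h0 : ∀ x, 0 ≤ f x) {x y : ℝ}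
    (hxy : x ≤ y) : ∫ t in x..y, f t ≤ ∫ t, f t := by
  rw [intervalIntegral.integral_of_le hxy]
  exact setIntegral_le_integral hf (Eventually.of_forall h0)

/-- Uniform bounds on paths of bounded energy. -/
theorem path_bound (k K : ℝ) (hk : 0 < k) : ∃ M : ℝ, 0 < M ∧ ∀ g, 1 ≤ g → ∀ p, Adm g p →
    p.J k g ≤ K → ∀ x, |p.A x| ≤ M ∧ |p.A1 x| ≤ M ∧ |p.B x| ≤ M := by
  rcases lt_or_ge K 0 with hK0 | hK0
  · refine ⟨1, one_pos, fun g hg p H hK => ?_⟩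
    have := (H.parts_le hk hg hK).2.2.2
    linarith
  set c := K + 1 / 2 with hc
  set c' := (K / k + 1) / 2 with hc'
  set R := 8 * K + 4 + 2 * c ^ 2 with hR
  set R' := 8 * K + 4 + 2 * c' ^ 2 with hR'
  have hRpos : 0 ≤ R := by positivity
  have hRpos' : 0 ≤ R' := by positivity
  refine ⟨12 * R + R' + 1, by positivity, fun g hg p H hK x => ?_⟩
  obtain ⟨hu, hv, hW, -⟩ := H.parts_le hk hg hK
  have hWi : ∫ t in x..x+1, Wp g (p.A t) (p.B t) ≤ K :=
    (interval_le_integral H.hW (fun t => Wp_nonneg hg _ _) (by linarith)).trans hW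
  have hWii : IntervalIntegrable (fun t => Wp g (p.A t) (p.B t)) volume x (x+1) :=
    H.Wcont.intervalIntegrable _ _
  have intR : ∀ e : ℝ, ∫ t in x..x+1, (8 * Wp g (p.A t) (p.B t) + e) ≤ 8 * K + e := by
    intro e
    rw [intervalIntegral.integral_add (hWii.const_mul _) (by simp),
      intervalIntegral.integral_const_mul]
    simp
    linarith
  have hA1 : ∀ y, |y - x| ≤ 1 → |p.A1 y - p.A1 x| ≤ c := by
    intro y hy
    have := H.hA1.young H.hu one_pos x y
    simp only [hc]
    linarith
  have hB : ∀ y, |y - x| ≤ 1 → |p.B y - p.B x| ≤ c' := by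
    intro y hy
    have := H.hB.young H.hv one_pos x y
    simp only [hc']
    linarith
  have hA : ∀ y ∈ Icc x (x+1), |p.A y - p.A x - p.A1 x * (y - x)| ≤ c := by
    intro y hy
    have hy1 : |y - x| ≤ 1 := by rw [abs_le]; constructor <;> linarith [hy.1, hy.2]
    have e : p.A y - p.A x - p.A1 x * (y - x) = ∫ t in x..y, (p.A1 t - p.A1 x) := by
      rw [intervalIntegral.integral_sub (H.hA.intble _ _) (by simp), ← H.hA.2]
      simp
      ring
    rw [e]
    have hc0 : 0 ≤ c := by positivity
    have := intervalIntegral.norm_integral_le_of_norm_le_const (a := x) (b := y)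
      (f := fun t => p.A1 t - p.A1 x) (C := c) (by
        intro t ht
        rw [uIoc_of_le hy.1] at ht
        apply hA1
        rw [abs_le]; constructor <;> linarith [hy.2, ht.1, ht.2])
    refine (this.trans ?_)
    nlinarith
  have hlin : p.A x ^ 2 + p.A x * p.A1 x + p.A1 x ^ 2 / 3 ≤ R := by
    have e : ∫ y in x..x+1, (p.A x + p.A1 x * (y - x)) ^ 2
        = p.A x ^ 2 + p.A x * p.A1 x + p.A1 x ^ 2 / 3 := by
      rw [intervalIntegral.integral_eq_sub_of_hasDerivAt
        (f := fun y => p.A x ^ 2 * (y - x) + p.A x * p.A1 x * (y - x) ^ 2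
          + p.A1 x ^ 2 / 3 * (y - x) ^ 3)]
      · ring
      · intro y _
        have h1 : HasDerivAt (fun y => y - x) 1 y := (hasDerivAt_id y).sub_const x
        convert! ((h1.const_mul (p.A x ^ 2)).add ((h1.pow 2).const_mul (p.A x * p.A1 x))).add
          ((h1.pow 3).const_mul (p.A1 x ^ 2 / 3)) using 1
        push_cast
        ring
      · apply Continuous.intervalIntegrable
        fun_prop
    rw [← e, hR, show 8 * K + 4 + 2 * c ^ 2 = 8 * K + (4 + 2 * c ^ 2) by ring]
    refine le_trans ?_ (intR _)
    apply intervalIntegral.integral_mono_on (by linarith)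
    · apply Continuous.intervalIntegrable
      fun_prop
    · exact (hWii.const_mul _).add (by simp)
    · intro y hy
      have h1 := hA y hy
      have h2 := sq_le_Wp hg (p.A y) (p.B y)
      have h3 : (p.A y - p.A x - p.A1 x * (y - x)) ^ 2 ≤ c ^ 2 := by
        rw [← sq_abs]
        gcongr
      nlinarith [sq_nonneg (p.A y + (p.A y - p.A x - p.A1 x * (y - x))), sq_nonneg (p.B y)]
  have hlinB : p.B x ^ 2 ≤ R' := by
    have e : ∫ y in x..x+1, (p.B x) ^ 2 = p.B x ^ 2 := by simp
    rw [← e, hR', show 8 * K + 4 + 2 * c' ^ 2 = 8 * K + (4 + 2 * c' ^ 2) by ring]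
    refine le_trans ?_ (intR _)
    apply intervalIntegral.integral_mono_on (by linarith)
    · simp
    · exact (hWii.const_mul _).add (by simp)
    · intro y hy
      have h1 := hB y (by rw [abs_le]; constructor <;> linarith [hy.1, hy.2])
      have h2 := sq_le_Wp hg (p.A y) (p.B y)
      have h3 : (p.B y - p.B x) ^ 2 ≤ c' ^ 2 := by
        rw [← sq_abs]
        gcongr
      nlinarith [sq_nonneg (p.B y + (p.B y - p.B x)), sq_nonneg (p.A y)]
  have hM : ∀ z : ℝ, z ^ 2 ≤ 12 * R + R' → |z| ≤ 12 * R + R' + 1 := by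
    intro z hz
    apply abs_le_of_sq_le_sq _ (by positivity)
    nlinarith
  refine ⟨hM _ ?_, hM _ ?_, hM _ ?_⟩
  · nlinarith [sq_nonneg (p.A x / 2 + p.A1 x / 3)]
  · nlinarith [sq_nonneg (p.A x + p.A1 x / 2)]
  · linarith

/-- Uniform continuity of observables along paths of bounded energy. -/
theorem path_unif (k K : ℝ) (hk : 0 < k) (G : ℝ × ℝ → ℝ) (hG : Continuous G) {δ : ℝ}
    (hδ : 0 < δ) : ∃ h : ℝ, 0 < h ∧ ∀ g, 1 ≤ g → ∀ p, Adm g p →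
    p.J k g ≤ K → ∀ x y, |y - x| ≤ h → |G (p.A y, p.B y) - G (p.A x, p.B x)| < δ := by
  obtain ⟨M, hM0, hM⟩ := path_bound k K hk
  have hcomp : IsCompact (Icc (-M) M ×ˢ Icc (-M) M) := isCompact_Icc.prod isCompact_Icc
  have huc := hcomp.uniformContinuousOn_of_continuous hG.continuousOn
  rw [Metric.uniformContinuousOn_iff] at huc
  obtain ⟨ρ, hρ, huc⟩ := huc δ hδ
  set c := (|K| / k + 1) / 2 with hc
  have hc0 : 0 < c := by positivity
  refine ⟨min (ρ / (2 * M)) ((ρ / (2 * c)) ^ 2), by positivity, fun g hg p H hK x y hxy => ?_⟩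
  obtain ⟨hu, hv, hW, hK0⟩ := H.parts_le hk hg hK
  have mem : ∀ x, (p.A x, p.B x) ∈ Icc (-M) M ×ˢ Icc (-M) M := fun x =>
    ⟨abs_le.1 (hM g hg p H hK x).1, abs_le.1 (hM g hg p H hK x).2.2⟩
  have h1 : |p.A y - p.A x| < ρ := by
    rw [H.hA.2]
    have := intervalIntegral.norm_integral_le_of_norm_le_const (a := x) (b := y)
      (f := p.A1) (C := M) (fun t _ => (hM g hg p H hK t).2.1)
    have h2 := hxy.trans (min_le_left _ _)
    have h3 : M * |y - x| ≤ M * (ρ / (2 * M)) := by gcongr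
    have e : M * (ρ / (2 * M)) = ρ / 2 := by field_simp
    rw [Real.norm_eq_abs] at this
    linarith
  have h2 : |p.B y - p.B x| < ρ := by
    have h2 := hxy.trans (min_le_right _ _)
    have h3 : √|y - x| ≤ ρ / (2 * c) := by
      rw [← Real.sqrt_sq (show 0 ≤ ρ / (2 * c) by positivity)]
      exact Real.sqrt_le_sqrt h2
    have h4 := H.hB.holder H.hv x y
    have h5 : ((∫ t, p.v t ^ 2) + 1) / 2 ≤ c := by
      rw [hc, abs_of_nonneg hK0]
      linarith
    have h6 : ((∫ t, p.v t ^ 2) + 1) / 2 * √|y - x| ≤ c * (ρ / (2 * c)) := by gcongr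
    have e : c * (ρ / (2 * c)) = ρ / 2 := by field_simp
    linarith
  have := huc _ (mem y) _ (mem x) (by
    rw [Prod.dist_eq]
    exact max_lt h1 h2)
  exact this

/-- Pointwise control by local integrals. -/
theorem path_ptwise (k K : ℝ) (hk : 0 < k) (G : ℝ × ℝ → ℝ) (hG : Continuous G) {δ : ℝ}
    (hδ : 0 < δ) : ∃ h : ℝ, 0 < h ∧ ∀ g, 1 ≤ g → ∀ p, Adm g p →
    p.J k g ≤ K → ∀ x, h * (G (p.A x, p.B x) - δ) ≤ ∫ t in x..x+h, G (p.A t, p.B t) := by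
  obtain ⟨h, h0, hh⟩ := path_unif k K hk G hG hδ
  refine ⟨h, h0, fun g hg p H hK x => ?_⟩
  have e : ∫ t in x..x+h, (G (p.A x, p.B x) - δ) = h * (G (p.A x, p.B x) - δ) := by
    simp
    ring
  rw [← e]
  apply intervalIntegral.integral_mono_on (by linarith) (by simp)
  · exact (hG.comp (H.hA.cont.prodMk H.hB.cont)).intervalIntegrable _ _
  · intro t ht
    have := hh g hg p H hK x t (by rw [abs_le]; constructor <;> linarith [ht.1, ht.2])
    rw [abs_lt] at this
    linarith

theorem tendsto_shift_integral {f : ℝ → ℝ} (hf : Integrable f) (h : ℝ) :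
    Tendsto (fun x => ∫ t in x..x+h, f t) atTop (𝓝 0) := by
  have h1 := intervalIntegral_tendsto_integral_Ioi (0:ℝ) hf.integrableOn
    (tendsto_id (α := ℝ) (x := atTop))
  have h2 := intervalIntegral_tendsto_integral_Ioi (0:ℝ) hf.integrableOn
    (tendsto_atTop_add_const_right atTop h (tendsto_id (α := ℝ) (x := atTop)))
  have := h2.sub h1
  simp only [sub_self, id] at this
  refine this.congr fun x => ?_
  rw [intervalIntegral.integral_interval_sub_left hf.intervalIntegrable hf.intervalIntegrable]

theorem path_W_tendsto {k g : ℝ} (hk : 0 < k) (hg : 1 ≤ g) {p : Pth} (H : Adm g p) :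
    Tendsto (fun x => Wp g (p.A x) (p.B x)) atTop (𝓝 0) := by
  rw [Metric.tendsto_atTop]
  intro ε hε
  obtain ⟨h, h0, hh⟩ := path_ptwise k (p.J k g) hk (fun z => Wp g z.1 z.2) (Wp_cont g)
    (half_pos hε)
  have h1 := tendsto_shift_integral H.hW h
  rw [Metric.tendsto_atTop] at h1
  obtain ⟨N, hN⟩ := h1 (h * (ε / 2)) (by positivity)
  refine ⟨N, fun x hx => ?_⟩
  have h2 := hN x hx
  have h3 := hh g hg p H le_rfl x
  simp only at h3
  rw [Real.dist_eq, sub_zero] at h2 ⊢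
  rw [abs_of_nonneg (Wp_nonneg hg _ _)]
  have h4 := (abs_lt.1 h2).2
  have h5 := h3.trans_lt h4
  have := lt_of_mul_lt_mul_left h5 h0.le
  linarith

/-- A continuous function whose square tends to one has a limit. -/
theorem tendsto_of_sq {s : ℝ → ℝ} (hs : Continuous s) (h : Tendsto (fun x => s x ^ 2) atTop (𝓝 1)) :
    ∃ σ : ℝ, σ ^ 2 = 1 ∧ Tendsto s atTop (𝓝 σ) := by
  have habs : Tendsto (fun x => |s x|) atTop (𝓝 1) := by
    have := (Real.continuous_sqrt.tendsto 1).comp h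
    simpa [Function.comp_def, Real.sqrt_sq_eq_abs] using this
  obtain ⟨N, hN⟩ := ((h.eventually (lt_mem_nhds (show (0:ℝ) < 1 by norm_num))).and
    (eventually_ge_atTop 0)).exists_forall_of_atTop
  have hne : ∀ x ≥ N, s x ≠ 0 := fun x hx h0 => by
    have := (hN x hx).1
    rw [h0] at this
    norm_num at this
  have hsame : ∀ x ≥ N, 0 < s N * s x := by
    intro x hx
    by_contra hcon
    push Not at hcon
    have h1 : s N * s N > 0 := by
      exact mul_self_pos.2 (hne N le_rfl)
    have := intermediate_value_Icc' hx (f := fun y => s N * s y) (by fun_prop)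
    obtain ⟨y, hy, hy0⟩ := this ⟨hcon, h1.le⟩
    rcases mul_eq_zero.1 hy0 with h2 | h2
    · exact hne N le_rfl h2
    · exact hne y hy.1 h2
  rcases lt_or_gt_of_ne (hne N le_rfl) with hneg | hpos
  · refine ⟨-1, by norm_num, ?_⟩
    refine (habs.neg).congr' ?_
    filter_upwards [eventually_ge_atTop N] with x hx
    have : s x < 0 := by nlinarith [hsame x hx]
    rw [abs_of_neg this, neg_neg]
  · refine ⟨1, by norm_num, ?_⟩
    refine habs.congr' ?_
    filter_upwards [eventually_ge_atTop N] with x hx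
    have : 0 < s x := by
      have := hsame x hx
      exact (mul_pos_iff_of_pos_left hpos).1 this
    rw [abs_of_pos this]

theorem tendsto_zero_of_sq {s : ℝ → ℝ} {l : Filter ℝ} (h : Tendsto (fun x => s x ^ 2) l (𝓝 0)) :
    Tendsto s l (𝓝 0) := by
  rw [tendsto_zero_iff_abs_tendsto_zero]
  have := (Real.continuous_sqrt.tendsto 0).comp h
  simpa [Function.comp_def, Real.sqrt_sq_eq_abs] using this

/-- Set of relevant equilibria. -/
def Eqm (σ τ : ℝ) : Prop := (σ ^ 2 = 1 ∧ τ = 0) ∨ (σ = 0 ∧ τ ^ 2 = 1)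

theorem path_limit {k g : ℝ} (hk : 0 < k) (hg : 1 < g) {p : Pth} (H : Adm g p) :
    ∃ σ τ, Eqm σ τ ∧ Tendsto p.A atTop (𝓝 σ) ∧ Tendsto p.A1 atTop (𝓝 0) ∧
      Tendsto p.B atTop (𝓝 τ) := by
  have hW := path_W_tendsto hk hg.le H
  have hg0 : 0 < g - 1 := by linarith
  have hq : Tendsto (fun x => p.A x ^ 2 + p.B x ^ 2 - 1) atTop (𝓝 0) := by
    apply tendsto_zero_of_sq
    have := hW.const_mul 4
    rw [mul_zero] at this
    refine squeeze_zero (fun x => sq_nonneg _) (fun x => ?_) this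
    unfold Wp
    have : 0 ≤ (g - 1) / 2 * (p.A x ^ 2 * p.B x ^ 2) := by positivity
    linarith
  have hAB : Tendsto (fun x => p.A x ^ 2 * p.B x ^ 2) atTop (𝓝 0) := by
    have := hW.const_mul (2 / (g - 1))
    rw [mul_zero] at this
    refine squeeze_zero (fun x => by positivity) (fun x => ?_) this
    unfold Wp
    have : 0 ≤ 2 / (g - 1) * ((p.A x ^ 2 + p.B x ^ 2 - 1) ^ 2 / 4) := by positivity
    have e : 2 / (g - 1) * ((g - 1) / 2 * (p.A x ^ 2 * p.B x ^ 2)) = p.A x ^ 2 * p.B x ^ 2 := by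
      field_simp
    rw [mul_add]
    linarith
  have hd : Tendsto (fun x => (p.A x ^ 2 - p.B x ^ 2) ^ 2) atTop (𝓝 1) := by
    have := ((hq.add_const 1).pow 2).sub (hAB.const_mul 4)
    norm_num at this
    refine this.congr fun x => ?_
    ring
  have hAc := H.hA.cont
  have hBc := H.hB.cont
  obtain ⟨d, hd1, hd⟩ := tendsto_of_sq (by fun_prop) hd
  have hA2 : Tendsto (fun x => p.A x ^ 2) atTop (𝓝 ((1 + d) / 2)) := by
    have := ((hq.add_const 1).add hd).div_const 2
    rw [zero_add] at this
    refine this.congr fun x => ?_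
    ring
  have hB2 : Tendsto (fun x => p.B x ^ 2) atTop (𝓝 ((1 - d) / 2)) := by
    have := ((hq.add_const 1).sub hd).div_const 2
    rw [zero_add] at this
    refine this.congr fun x => ?_
    ring
  have main : ∃ σ τ, Eqm σ τ ∧ Tendsto p.A atTop (𝓝 σ) ∧ Tendsto p.B atTop (𝓝 τ) := by
    rcases (by simpa using hd1 : d = 1 ∨ d = -1) with rfl | rfl
    · norm_num at hA2 hB2
      obtain ⟨σ, h1, h2⟩ := tendsto_of_sq hAc hA2
      exact ⟨σ, 0, Or.inl ⟨h1, rfl⟩, h2, tendsto_zero_of_sq hB2⟩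
    · norm_num at hA2 hB2
      obtain ⟨σ, h1, h2⟩ := tendsto_of_sq hBc hB2
      exact ⟨0, σ, Or.inr ⟨rfl, h1⟩, tendsto_zero_of_sq hA2, h2⟩
  obtain ⟨σ, τ, h1, h2, h3⟩ := main
  refine ⟨σ, τ, h1, h2, ?_, h3⟩
  set C := ((∫ t, p.u t ^ 2) + 1) / 2 with hC
  have hC0 : 0 < C := by
    have : 0 ≤ ∫ x, p.u x ^ 2 := integral_nonneg fun x => sq_nonneg _
    positivity
  rw [Metric.tendsto_atTop]
  intro ε hε
  set h := (ε / (2 * C)) ^ 2 with hh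
  have hh0 : 0 < h := by positivity
  have hdiff : Tendsto (fun x => p.A (x + h) - p.A x) atTop (𝓝 0) := by
    have := (h2.comp (tendsto_atTop_add_const_right atTop h tendsto_id)).sub h2
    simpa using this
  rw [Metric.tendsto_atTop] at hdiff
  obtain ⟨N, hN⟩ := hdiff (h * (ε / 2)) (by positivity)
  refine ⟨N, fun x hx => ?_⟩
  have h4 := hN x hx
  rw [Real.dist_eq, sub_zero] at h4 ⊢
  have h5 : |p.A (x + h) - p.A x - h * p.A1 x| ≤ ε / 2 * h := by
    have e : p.A (x + h) - p.A x - h * p.A1 x = ∫ t in x..x+h, (p.A1 t - p.A1 x) := by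
      rw [intervalIntegral.integral_sub (H.hA.intble _ _) (by simp), ← H.hA.2]
      simp
    rw [e]
    have := intervalIntegral.norm_integral_le_of_norm_le_const (a := x) (b := x + h)
      (f := fun t => p.A1 t - p.A1 x) (C := ε / 2) (by
        intro t ht
        rw [uIoc_of_le (by linarith)] at ht
        have h6 := H.hA1.holder H.hu x t
        rw [← hC] at h6
        have h7 : √|t - x| ≤ ε / (2 * C) := by
          rw [← Real.sqrt_sq (show 0 ≤ ε / (2 * C) by positivity)]
          apply Real.sqrt_le_sqrt
          rw [abs_le]; constructor <;> linarith [ht.1, ht.2]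
        have h8 : C * √|t - x| ≤ C * (ε / (2 * C)) := by gcongr
        have e : C * (ε / (2 * C)) = ε / 2 := by field_simp
        rw [Real.norm_eq_abs]
        linarith)
    simpa [abs_of_pos hh0] using this
  have h6 : h * |p.A1 x| < h * ε := by
    have e : h * |p.A1 x| = |h * p.A1 x| := by rw [abs_mul, abs_of_pos hh0]
    rw [e]
    rw [abs_le] at h5
    rw [abs_lt] at h4 ⊢
    constructor <;> linarith [h5.1, h5.2, h4.1, h4.2]
  exact lt_of_mul_lt_mul_left h6 hh0.le


/-! ### Operations on paths -/

/-- Translation. -/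
def Pth.shift (p : Pth) (c : ℝ) : Pth :=
  ⟨fun x => p.A (x + c), fun x => p.A1 (x + c), fun x => p.u (x + c), fun x => p.B (x + c),
    fun x => p.v (x + c)⟩

/-- Reflection. -/
def Pth.refl (p : Pth) : Pth :=
  ⟨fun x => p.A (-x), fun x => - p.A1 (-x), fun x => p.u (-x), fun x => p.B (-x),
    fun x => - p.v (-x)⟩

theorem Adm.shift {g : ℝ} {p : Pth} (H : Adm g p) (c : ℝ) : Adm g (p.shift c) where
  hA := H.hA.shift c
  hA1 := H.hA1.shift c
  hB := H.hB.shift c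
  hu := H.hu.comp_add_right c
  hv := H.hv.comp_add_right c
  hW := H.hW.comp_add_right c

theorem Pth.J_shift (p : Pth) (k g c : ℝ) : (p.shift c).J k g = p.J k g :=
  integral_add_right_eq_self (p.dens k g) c

theorem Adm.refl {g : ℝ} {p : Pth} (H : Adm g p) : Adm g p.refl where
  hA := H.hA.refl
  hA1 := by
    have := H.hA1.refl.neg
    simp only [neg_neg] at this
    exact this
  hB := H.hB.refl
  hu := H.hu.comp_neg
  hv := by
    have := H.hv.comp_neg
    simpa only [Pth.refl, neg_sq] using this
  hW := H.hW.comp_neg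

theorem Pth.dens_refl (p : Pth) (k g x : ℝ) : p.refl.dens k g x = p.dens k g (-x) := by
  simp [Pth.dens, Pth.refl]

theorem Pth.J_refl (p : Pth) (k g : ℝ) : p.refl.J k g = p.J k g := by
  unfold Pth.J
  simp only [Pth.dens_refl]
  exact integral_neg_eq_self (p.dens k g) volume

/-- Connecting paths. -/
structure Conn (g : ℝ) (p : Pth) : Prop where
  adm : Adm g p
  bot : Tendsto (fun x => p.A x ^ 2 - p.B x ^ 2) atBot (𝓝 1)
  top : Tendsto (fun x => p.A x ^ 2 - p.B x ^ 2) atTop (𝓝 (-1))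

theorem exists_cutoff : ∃ χ χ1 χ2 : ℝ → ℝ, (∀ x, HasDerivAt χ (χ1 x) x) ∧
    (∀ x, HasDerivAt χ1 (χ2 x) x) ∧ Continuous χ2 ∧ χ 0 = 1 ∧ χ1 0 = 0 ∧
    ∀ s, 1 ≤ s → χ s = 0 ∧ χ1 s = 0 ∧ χ2 s = 0 := by
  set χ : ℝ → ℝ := fun s => 1 - Real.smoothTransition (2 * s - 1 / 2) with hχ
  have hc : ContDiff ℝ 2 χ := by
    have : ContDiff ℝ 2 Real.smoothTransition := Real.smoothTransition.contDiff (n := 2)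
    fun_prop
  have hc1 : ContDiff ℝ 1 (deriv χ) := by
    have := (contDiff_succ_iff_deriv (n := 1) (f := χ)).1 (by norm_num; exact hc)
    exact this.2.2
  have hd0 : Differentiable ℝ χ := hc.differentiable (by norm_num)
  have hd1 : Differentiable ℝ (deriv χ) := hc1.differentiable (by norm_num)
  have hz : ∀ s : ℝ, 3/4 < s → χ s = 0 := by
    intro s hs
    simp only [hχ]
    rw [Real.smoothTransition.one_of_one_le (by linarith)]
    ring
  have hz1 : ∀ s : ℝ, 3/4 < s → deriv χ s = 0 := by
    intro s hs
    have : χ =ᶠ[𝓝 s] fun _ => 0 := by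
      filter_upwards [lt_mem_nhds hs] with t ht using hz t ht
    rw [this.deriv_eq]
    simp
  have hz2 : ∀ s : ℝ, 3/4 < s → deriv (deriv χ) s = 0 := by
    intro s hs
    have : deriv χ =ᶠ[𝓝 s] fun _ => 0 := by
      filter_upwards [lt_mem_nhds hs] with t ht using hz1 t ht
    rw [this.deriv_eq]
    simp
  have ho : χ =ᶠ[𝓝 0] fun _ => 1 := by
    filter_upwards [gt_mem_nhds (show (0:ℝ) < 1/4 by norm_num)] with t ht
    simp only [hχ]
    rw [Real.smoothTransition.zero_of_nonpos (by linarith)]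
    ring
  refine ⟨χ, deriv χ, deriv (deriv χ), fun x => (hd0 x).hasDerivAt, fun x => (hd1 x).hasDerivAt,
    hc1.continuous_deriv (by norm_num), ho.self_of_nhds, ?_, fun s hs =>
    ⟨hz s (by linarith), hz1 s (by linarith), hz2 s (by linarith)⟩⟩
  rw [ho.deriv_eq]
  simp

theorem glue_integral {f1 f2 : ℝ → ℝ} (c : ℝ) (h1 : Integrable f1) (h2 : Continuous f2)
    (h0 : ∀ x, c + 1 ≤ x → f2 x = 0) :
    Integrable (fun x => if x ≤ c then f1 x else f2 x) ∧
    ∫ x, (if x ≤ c then f1 x else f2 x) = (∫ x in Iic c, f1 x) + ∫ x in c..c+1, f2 x := by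
  have hz : EqOn f2 (fun _ => 0) (Ioi (c+1)) := fun x hx => h0 x (le_of_lt hx)
  have hIoi : Ioi c = Ioc c (c+1) ∪ Ioi (c+1) := (Ioc_union_Ioi_eq_Ioi (by linarith)).symm
  have hi1 : IntegrableOn f2 (Ioc c (c+1)) := (h2.intervalIntegrable c (c+1)).1
  have hi2 : IntegrableOn f2 (Ioi (c+1)) :=
    IntegrableOn.congr_fun (integrableOn_zero) hz.symm measurableSet_Ioi
  have hi : IntegrableOn f2 (Ioi c) := by
    rw [hIoi]
    exact hi1.union hi2
  have hgInt : Integrable (fun x => if x ≤ c then f1 x else f2 x) :=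
    Integrable.piecewise (s := Iic c) measurableSet_Iic h1.integrableOn
      (by rw [compl_Iic]; exact hi)
  refine ⟨hgInt, ?_⟩
  rw [← integral_add_compl (measurableSet_Iic (a := c)) hgInt, compl_Iic]
  congr 1
  · apply setIntegral_congr_fun measurableSet_Iic
    intro x hx
    simp [mem_Iic.1 hx]
  · have e1 : ∫ x in Ioi c, (if x ≤ c then f1 x else f2 x) = ∫ x in Ioi c, f2 x := by
      apply setIntegral_congr_fun measurableSet_Ioi
      intro x hx
      simp [not_le.2 (mem_Ioi.1 hx)]
    rw [e1, hIoi, setIntegral_union (Ioc_disjoint_Ioi le_rfl) measurableSet_Ioi hi1 hi2,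
      setIntegral_congr_fun measurableSet_Ioi hz, intervalIntegral.integral_of_le (by linarith)]
    simp

theorem Wp_eqm {g σ τ : ℝ} (h : Eqm σ τ) : Wp g σ τ = 0 := by
  unfold Wp
  rcases h with ⟨h1, h2⟩ | ⟨h1, h2⟩
  · rw [h2, h1]; norm_num
  · rw [h1, h2]; norm_num

theorem glue_exists (k g : ℝ) {σ τ : ℝ} (hστ : Eqm σ τ) :
    ∃ Φ : ℝ × ℝ × ℝ → ℝ, Continuous Φ ∧ Φ 0 = 0 ∧ ∀ p, Adm g p → ∀ x0, ∃ q, Adm g q ∧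
      (∀ x ≤ x0, q.A x = p.A x ∧ q.B x = p.B x) ∧ (∀ x, x0 + 1 < x → q.A x = σ ∧ q.B x = τ) ∧
      q.J k g = (∫ x in Iic x0, p.dens k g x) + Φ (p.A x0 - σ, p.A1 x0, p.B x0 - τ) := by
  obtain ⟨χ, χ1, χ2, hd0, hd1, hc2, h01, h00, hs⟩ := exists_cutoff
  have hc0 : Continuous χ := continuous_iff_continuousAt.2 fun x => (hd0 x).continuousAt
  have hc1 : Continuous χ1 := continuous_iff_continuousAt.2 fun x => (hd1 x).continuousAt
  set gA : ℝ × ℝ × ℝ → ℝ → ℝ := fun z s => σ + (z.1 + z.2.1 * s) * χ s with hgA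
  set gA1 : ℝ × ℝ × ℝ → ℝ → ℝ := fun z s => z.2.1 * χ s + (z.1 + z.2.1 * s) * χ1 s with hgA1
  set gA2 : ℝ × ℝ × ℝ → ℝ → ℝ := fun z s => 2 * z.2.1 * χ1 s + (z.1 + z.2.1 * s) * χ2 s with hgA2
  set gB : ℝ × ℝ × ℝ → ℝ → ℝ := fun z s => τ + z.2.2 * χ s with hgB
  set gB1 : ℝ × ℝ × ℝ → ℝ → ℝ := fun z s => z.2.2 * χ1 s with hgB1
  set D : ℝ × ℝ × ℝ → ℝ → ℝ := fun z s =>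
    gA2 z s ^ 2 / 2 + k * gB1 z s ^ 2 + Wp g (gA z s) (gB z s) with hD
  have hDc : Continuous (Function.uncurry D) := by
    simp only [hD, hgA, hgA2, hgB, hgB1, Wp]
    unfold Function.uncurry
    fun_prop
  refine ⟨fun z => ∫ s in (0:ℝ)..1, D z s,
    intervalIntegral.continuous_parametric_intervalIntegral_of_continuous' hDc 0 1, ?_, ?_⟩
  · have : ∀ s, D 0 s = 0 := by
      intro s
      simp [hD, hgA, hgA2, hgB, hgB1, Wp_eqm hστ]
    simp [this]
  intro p H x0
  set z : ℝ × ℝ × ℝ := (p.A x0 - σ, p.A1 x0, p.B x0 - τ) with hz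
  have eD : ∫ s in (0:ℝ)..1, D z s = ∫ x in x0..x0+1, D z (x - x0) := by
    rw [intervalIntegral.integral_comp_sub_right (D z) x0]
    simp
  have hsub : ∀ x, HasDerivAt (fun x => x - x0) 1 x := fun x => (hasDerivAt_id x).sub_const x0
  have dχ : ∀ x, HasDerivAt (fun x => χ (x - x0)) (χ1 (x - x0)) x := fun x => by
    have := (hd0 (x - x0)).comp x (hsub x)
    rw [mul_one] at this
    exact this
  have dχ1 : ∀ x, HasDerivAt (fun x => χ1 (x - x0)) (χ2 (x - x0)) x := fun x => by
    have := (hd1 (x - x0)).comp x (hsub x)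
    rw [mul_one] at this
    exact this
  have dl : ∀ x, HasDerivAt (fun x => z.1 + z.2.1 * (x - x0)) (z.2.1) x := fun x => by
    simpa using ((hsub x).const_mul z.2.1).const_add z.1
  have PA : Prim (fun x => gA z (x - x0)) (fun x => gA1 z (x - x0)) := by
    apply Prim.of_hasDerivAt
    · simp only [hgA1]; fun_prop
    · intro x
      exact ((dl x).mul (dχ x)).const_add σ
  have PA1 : Prim (fun x => gA1 z (x - x0)) (fun x => gA2 z (x - x0)) := by
    apply Prim.of_hasDerivAt
    · simp only [hgA2]; fun_prop
    · intro x
      refine (((dχ x).const_mul z.2.1).add ((dl x).mul (dχ1 x))).congr_deriv ?_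
      simp only [hgA2]
      ring
  have PB : Prim (fun x => gB z (x - x0)) (fun x => gB1 z (x - x0)) := by
    apply Prim.of_hasDerivAt
    · simp only [hgB1]; fun_prop
    · intro x
      exact ((dχ x).const_mul z.2.2).const_add τ
  have late : ∀ x, x0 + 1 ≤ x → gA z (x - x0) = σ ∧ gA2 z (x - x0) = 0 ∧ gB z (x - x0) = τ ∧
      gB1 z (x - x0) = 0 := by
    intro x hx
    obtain ⟨e0, e1, e2⟩ := hs (x - x0) (by linarith)
    simp only [hgA, hgA2, hgB, hgB1, e0, e1, e2]
    simp
  let q : Pth :=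
    { A := fun x => if x ≤ x0 then p.A x else gA z (x - x0)
      A1 := fun x => if x ≤ x0 then p.A1 x else gA1 z (x - x0)
      u := fun x => if x ≤ x0 then p.u x else gA2 z (x - x0)
      B := fun x => if x ≤ x0 then p.B x else gB z (x - x0)
      v := fun x => if x ≤ x0 then p.v x else gB1 z (x - x0) }
  have cu : Continuous fun x => gA2 z (x - x0) ^ 2 := by simp only [hgA2]; fun_prop
  have cv : Continuous fun x => gB1 z (x - x0) ^ 2 := by simp only [hgB1]; fun_prop
  have cW : Continuous fun x => Wp g (gA z (x - x0)) (gB z (x - x0)) := by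
    simp only [hgA, hgB, Wp]; fun_prop
  have cD : Continuous fun x => D z (x - x0) := by
    simp only [hD, hgA, hgA2, hgB, hgB1, Wp]; fun_prop
  refine ⟨q, ⟨?_, ?_, ?_, ?_, ?_, ?_⟩, ?_, ?_, ?_⟩
  · exact H.hA.glue PA x0 (by simp [hgA, h01, hz])
  · exact H.hA1.glue PA1 x0 (by simp [hgA1, h01, h00, hz])
  · exact H.hB.glue PB x0 (by simp [hgB, h01, hz])
  · have := (glue_integral x0 H.hu cu (fun x hx => by simp [(late x hx).2.1])).1
    refine this.congr (Eventually.of_forall fun x => ?_)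
    simp only [q]
    split_ifs <;> rfl
  · have := (glue_integral x0 H.hv cv (fun x hx => by simp [(late x hx).2.2.2])).1
    refine this.congr (Eventually.of_forall fun x => ?_)
    simp only [q]
    split_ifs <;> rfl
  · have := (glue_integral x0 H.hW cW
      (fun x hx => by rw [(late x hx).1, (late x hx).2.2.1, Wp_eqm hστ])).1
    refine this.congr (Eventually.of_forall fun x => ?_)
    simp only [q]
    split_ifs <;> rfl
  · intro x hx
    simp [q, hx]
  · intro x hx
    have := late x hx.le
    simp [q, show ¬ x ≤ x0 by linarith, this]
  · have := (glue_integral x0 (H.dens_int k) cD (fun x hx => by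
      obtain ⟨e1, e2, e3, e4⟩ := late x hx
      simp [hD, e1, e2, e3, e4, Wp_eqm hστ])).2
    simp only [eD]
    rw [← this]
    unfold Pth.J
    congr 1
    funext x
    simp only [Pth.dens, q, hD]
    split_ifs <;> rfl

/-- The infimum of the energy. -/
noncomputable def infJ (k g : ℝ) : ℝ := sInf {e | ∃ p, Conn g p ∧ e = p.J k g}

theorem Pth.J_nonneg {k g : ℝ} (hk : 0 < k) (hg : 1 ≤ g) (p : Pth) : 0 ≤ p.J k g := by
  apply integral_nonneg
  intro x
  have := Wp_nonneg hg (p.A x) (p.B x)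
  simp only [Pth.dens, Pi.zero_apply]
  positivity

theorem infJ_le {k g : ℝ} (hk : 0 < k) (hg : 1 ≤ g) {p : Pth} (hp : Conn g p) :
    infJ k g ≤ p.J k g :=
  csInf_le ⟨0, by rintro e ⟨q, -, rfl⟩; exact q.J_nonneg hk hg⟩ ⟨p, hp, rfl⟩

/-- Cutting on the right near the good equilibrium. -/
theorem cut_right {k g : ℝ} (hk : 0 < k) (hg : 1 ≤ g) {σ τ : ℝ} (h1 : σ = 0) (h2 : τ ^ 2 = 1) :
    ∃ Φ : ℝ × ℝ × ℝ → ℝ, Continuous Φ ∧ Φ 0 = 0 ∧ ∀ p, Conn g p → ∀ x0,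
      infJ k g ≤ (∫ x in Iic x0, p.dens k g x) + Φ (p.A x0 - σ, p.A1 x0, p.B x0 - τ) := by
  obtain ⟨Φ, hΦ, hΦ0, h⟩ := glue_exists k g (σ := σ) (τ := τ) (Or.inr ⟨h1, h2⟩)
  refine ⟨Φ, hΦ, hΦ0, fun p hp x0 => ?_⟩
  obtain ⟨q, hq, ha, hb, hJ⟩ := h p hp.adm x0
  rw [← hJ]
  apply infJ_le hk hg
  refine ⟨hq, hp.bot.congr' ?_, tendsto_const_nhds.congr' ?_⟩
  · filter_upwards [eventually_le_atBot x0] with x hx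
    rw [(ha x hx).1, (ha x hx).2]
  · filter_upwards [eventually_gt_atTop (x0 + 1)] with x hx
    rw [(hb x hx).1, (hb x hx).2, h1, h2]
    norm_num

/-- Cutting on the left. -/
theorem cut_left {k g : ℝ} (hk : 0 < k) (hg : 1 ≤ g) {σ τ : ℝ} (h1 : σ ^ 2 = 1) (h2 : τ = 0) :
    ∃ Φ : ℝ × ℝ × ℝ → ℝ, Continuous Φ ∧ Φ 0 = 0 ∧ ∀ p, Conn g p → ∀ x0,
      infJ k g ≤ (∫ x in Ioi x0, p.dens k g x) + Φ (p.A x0 - σ, - p.A1 x0, p.B x0 - τ) := by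
  obtain ⟨Φ, hΦ, hΦ0, h⟩ := glue_exists k g (σ := σ) (τ := τ) (Or.inl ⟨h1, h2⟩)
  refine ⟨Φ, hΦ, hΦ0, fun p hp x0 => ?_⟩
  obtain ⟨q, hq, ha, hb, hJ⟩ := h p.refl hp.adm.refl (-x0)
  have e : ∫ x in Iic (-x0), p.refl.dens k g x = ∫ x in Ioi x0, p.dens k g x := by
    simp only [Pth.dens_refl]
    rw [integral_comp_neg_Iic]
    simp
  have e2 : (p.refl.A (-x0) - σ, p.refl.A1 (-x0), p.refl.B (-x0) - τ)
      = (p.A x0 - σ, - p.A1 x0, p.B x0 - τ) := by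
    simp [Pth.refl]
  rw [e, e2] at hJ
  rw [← hJ, ← q.J_refl]
  apply infJ_le hk hg
  refine ⟨hq.refl, tendsto_const_nhds.congr' ?_, hp.top.congr' ?_⟩
  · filter_upwards [eventually_lt_atBot (x0 - 1)] with x hx
    have := hb (-x) (by linarith)
    simp only [Pth.refl]
    rw [this.1, this.2, h1, h2]
    norm_num
  · filter_upwards [eventually_ge_atTop x0] with x hx
    have := ha (-x) (by linarith)
    simp only [Pth.refl] at this ⊢
    rw [this.1, this.2, neg_neg]


/-! ### Weak compactness -/

theorem weak_L2 (u : ℕ → ℝ → ℝ) (hu : ∀ n, MemLp (u n) 2 volume) (K : ℝ)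
    (hK : ∀ n, ∫ x, u n x ^ 2 ≤ K) : ∃ φ : ℕ → ℕ, StrictMono φ ∧ ∃ w : ℝ → ℝ, MemLp w 2 volume ∧
    ∀ h : ℝ → ℝ, MemLp h 2 volume →
      Tendsto (fun n => ∫ x, h x * u (φ n) x) atTop (𝓝 (∫ x, h x * w x)) := by
  have inner_eq : ∀ f h : ℝ → ℝ, ∀ (hf : MemLp f 2 volume) (hh : MemLp h 2 volume),
      inner ℝ (hf.toLp f) (hh.toLp h) = ∫ x, h x * f x := by
    intro f h hf hh
    rw [L2.inner_def]
    apply integral_congr_ae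
    filter_upwards [hf.coeFn_toLp, hh.coeFn_toLp] with x h1 h2
    rw [h1, h2]
    simp
  set U : ℕ → Lp ℝ 2 (volume : Measure ℝ) := fun n => (hu n).toLp (u n) with hU
  have hnorm : ∀ n, ‖U n‖ ≤ √K := by
    intro n
    apply Real.le_sqrt_of_sq_le
    rw [← real_inner_self_eq_norm_sq, inner_eq]
    refine le_trans (le_of_eq ?_) (hK n)
    congr 1
    funext x
    ring
  have hsc := WeakDual.isSeqCompact_closedBall ℝ (Lp ℝ 2 (volume : Measure ℝ)) 0 (√K)
  let X : ℕ → WeakDual ℝ (Lp ℝ 2 (volume : Measure ℝ)) := fun n =>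
    StrongDual.toWeakDual (InnerProductSpace.toDual ℝ _ (U n))
  obtain ⟨a, -, φ, hφ, hlim⟩ := hsc (x := X) (by
    intro n
    simp only [mem_preimage, Metric.mem_closedBall, dist_zero_right]
    have : WeakDual.toStrongDual (X n) = InnerProductSpace.toDual ℝ _ (U n) := rfl
    rw [this]
    simpa using hnorm n)
  set wl : Lp ℝ 2 (volume : Measure ℝ) :=
    (InnerProductSpace.toDual ℝ _).symm (WeakDual.toStrongDual a) with hwl
  refine ⟨φ, hφ, wl, Lp.memLp wl, fun h hh => ?_⟩
  have h1 : Tendsto (fun n => (X (φ n)) (hh.toLp h)) atTop (𝓝 (a (hh.toLp h))) :=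
    ((WeakDual.eval_continuous (hh.toLp h)).tendsto a).comp hlim
  have h2 : ∀ n, (X (φ n)) (hh.toLp h) = ∫ x, h x * u (φ n) x := by
    intro n
    have : (X (φ n)) (hh.toLp h) = inner ℝ (U (φ n)) (hh.toLp h) := rfl
    rw [this, inner_eq]
  have h3 : a (hh.toLp h) = ∫ x, h x * wl x := by
    have e : a (hh.toLp h) = inner ℝ wl (hh.toLp h) := by
      rw [hwl, InnerProductSpace.toDual_symm_apply]
      rfl
    have e2 : wl = (Lp.memLp wl).toLp wl := by simp
    rw [e]
    conv_lhs => rw [e2]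
    rw [inner_eq]
  simpa only [h2, h3] using h1

theorem interval_rep (x : ℝ) : ∃ h : ℝ → ℝ, MemLp h 2 volume ∧
    ∀ f : ℝ → ℝ, ∫ t, h t * f t = ∫ t in (0:ℝ)..x, f t := by
  have hm : ∀ a b : ℝ, MemLp ((Ioc a b).indicator fun _ => (1:ℝ)) 2 volume := fun a b =>
    memLp_indicator_const 2 measurableSet_Ioc 1 (Or.inr (by simp))
  have hi : ∀ (a b : ℝ) (f : ℝ → ℝ),
      ∫ t, (Ioc a b).indicator (fun _ => (1:ℝ)) t * f t = ∫ t in Ioc a b, f t := by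
    intro a b f
    rw [← integral_indicator measurableSet_Ioc]
    congr 1
    funext t
    by_cases ht : t ∈ Ioc a b <;> simp [ht]
  rcases le_total 0 x with hx | hx
  · refine ⟨_, hm 0 x, fun f => ?_⟩
    rw [hi, intervalIntegral.integral_of_le hx]
  · refine ⟨_, (hm x 0).neg, fun f => ?_⟩
    rw [intervalIntegral.integral_of_ge hx, ← hi, ← integral_neg]
    congr 1
    funext t
    simp

theorem Adm.memu {g : ℝ} {p : Pth} (H : Adm g p) : MemLp p.u 2 volume :=
  (memLp_two_iff_integrable_sq H.hA1.1.aestronglyMeasurable).2 H.hu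

theorem Adm.memv {g : ℝ} {p : Pth} (H : Adm g p) : MemLp p.v 2 volume :=
  (memLp_two_iff_integrable_sq H.hB.1.aestronglyMeasurable).2 H.hv

theorem weak_lower {u w : ℝ → ℝ} (hu : MemLp u 2 volume) (hw : MemLp w 2 volume) :
    2 * (∫ x, w x * u x) - ∫ x, w x ^ 2 ≤ ∫ x, u x ^ 2 := by
  have i1 : Integrable fun x => w x * u x := hw.integrable_mul hu
  have i2 := hw.integrable_sq
  have i3 := hu.integrable_sq
  rw [← integral_const_mul, ← integral_sub (i1.const_mul 2) i2]
  apply integral_mono ((i1.const_mul 2).sub i2) i3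
  intro x
  simp only [Pi.sub_apply]
  nlinarith [sq_nonneg (u x - w x)]

theorem Wp_tendsto {ι : Type*} {l : Filter ι} (g : ℝ) {a b : ι → ℝ} {a0 b0 : ℝ}
    (ha : Tendsto a l (𝓝 a0)) (hb : Tendsto b l (𝓝 b0)) :
    Tendsto (fun n => Wp g (a n) (b n)) l (𝓝 (Wp g a0 b0)) := by
  unfold Wp
  exact (((((ha.pow 2).add (hb.pow 2)).sub_const 1).pow 2).div_const 4).add
    (((ha.pow 2).mul (hb.pow 2)).const_mul _)

theorem path_compact {k g : ℝ} (hk : 0 < k) (hg : 1 ≤ g) (p : ℕ → Pth) (H : ∀ n, Adm g (p n))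
    (m : ℝ) (hm : Tendsto (fun n => (p n).J k g) atTop (𝓝 m)) :
    ∃ φ : ℕ → ℕ, StrictMono φ ∧ ∃ q, Adm g q ∧ q.J k g ≤ m ∧
      (∀ x, Tendsto (fun n => (p (φ n)).A x) atTop (𝓝 (q.A x))) ∧
      (∀ x, Tendsto (fun n => (p (φ n)).A1 x) atTop (𝓝 (q.A1 x))) ∧
      (∀ x, Tendsto (fun n => (p (φ n)).B x) atTop (𝓝 (q.B x))) := by
  obtain ⟨K, hK⟩ := hm.bddAbove_range
  replace hK : ∀ n, (p n).J k g ≤ K := fun n => hK ⟨n, rfl⟩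
  obtain ⟨M, hM0, hM⟩ := path_bound k K hk
  have hM : ∀ n x, |(p n).A x| ≤ M ∧ |(p n).A1 x| ≤ M ∧ |(p n).B x| ≤ M :=
    fun n => hM g hg (p n) (H n) (hK n)
  obtain ⟨φ1, hφ1, w, hw, hwl⟩ := weak_L2 (fun n => (p n).u) (fun n => (H n).memu) (2 * K)
    (fun n => ((H n).parts_le hk hg (hK n)).1)
  obtain ⟨φ2, hφ2, z, hz, hzl⟩ := weak_L2 (fun n => (p (φ1 n)).v) (fun n => (H _).memv) (K / k)
    (fun n => ((H _).parts_le hk hg (hK _)).2.1)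
  obtain ⟨c, -, φ3, hφ3, hc⟩ := tendsto_subseq_of_bounded
    (s := Icc (-M) M ×ˢ Icc (-M) M ×ˢ Icc (-M) M)
    ((isCompact_Icc.prod (isCompact_Icc.prod isCompact_Icc)).isBounded)
    (x := fun n => ((p (φ1 (φ2 n))).A 0, (p (φ1 (φ2 n))).A1 0, (p (φ1 (φ2 n))).B 0))
    (fun n => ⟨abs_le.1 (hM _ 0).1, abs_le.1 (hM _ 0).2.1, abs_le.1 (hM _ 0).2.2⟩)
  set φ : ℕ → ℕ := fun n => φ1 (φ2 (φ3 n)) with hφ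
  have hφm : StrictMono φ := hφ1.comp (hφ2.comp hφ3)
  have cA : Tendsto (fun n => (p (φ n)).A 0) atTop (𝓝 c.1) := (continuous_fst.tendsto c).comp hc
  have cA1 : Tendsto (fun n => (p (φ n)).A1 0) atTop (𝓝 c.2.1) :=
    ((continuous_fst.comp continuous_snd).tendsto c).comp hc
  have cB : Tendsto (fun n => (p (φ n)).B 0) atTop (𝓝 c.2.2) :=
    ((continuous_snd.comp continuous_snd).tendsto c).comp hc
  have wu : ∀ h : ℝ → ℝ, MemLp h 2 volume →
      Tendsto (fun n => ∫ x, h x * (p (φ n)).u x) atTop (𝓝 (∫ x, h x * w x)) := fun h hh =>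
    (hwl h hh).comp ((hφ2.comp hφ3).tendsto_atTop)
  have wv : ∀ h : ℝ → ℝ, MemLp h 2 volume →
      Tendsto (fun n => ∫ x, h x * (p (φ n)).v x) atTop (𝓝 (∫ x, h x * z x)) := fun h hh =>
    (hzl h hh).comp hφ3.tendsto_atTop
  have locw : LocallyIntegrable w volume := hw.locallyIntegrable (by norm_num)
  have locz : LocallyIntegrable z volume := hz.locallyIntegrable (by norm_num)
  let qA1 : ℝ → ℝ := fun x => c.2.1 + ∫ t in (0:ℝ)..x, w t
  let qA : ℝ → ℝ := fun x => c.1 + ∫ t in (0:ℝ)..x, qA1 t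
  let qB : ℝ → ℝ := fun x => c.2.2 + ∫ t in (0:ℝ)..x, z t
  have PA1 : Prim qA1 w := Prim.of_base locw 0 (fun y => by simp [qA1])
  have PA : Prim qA qA1 := Prim.of_base PA1.cont.locallyIntegrable 0 (fun y => by simp [qA])
  have PB : Prim qB z := Prim.of_base locz 0 (fun y => by simp [qB])
  have lA1 : ∀ x, Tendsto (fun n => (p (φ n)).A1 x) atTop (𝓝 (qA1 x)) := by
    intro x
    obtain ⟨h, hh, hr⟩ := interval_rep x
    have := cA1.add (wu h hh)
    simp only [hr] at this
    refine this.congr fun n => ?_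
    rw [← (H (φ n)).hA1.2]
    ring
  have lB : ∀ x, Tendsto (fun n => (p (φ n)).B x) atTop (𝓝 (qB x)) := by
    intro x
    obtain ⟨h, hh, hr⟩ := interval_rep x
    have := cB.add (wv h hh)
    simp only [hr] at this
    refine this.congr fun n => ?_
    rw [← (H (φ n)).hB.2]
    ring
  have lA : ∀ x, Tendsto (fun n => (p (φ n)).A x) atTop (𝓝 (qA x)) := by
    intro x
    have h1 : Tendsto (fun n => ∫ t in (0:ℝ)..x, (p (φ n)).A1 t) atTop
        (𝓝 (∫ t in (0:ℝ)..x, qA1 t)) := by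
      apply intervalIntegral.tendsto_integral_filter_of_dominated_convergence (fun _ => M)
      · exact Eventually.of_forall fun n => (H _).hA1.cont.aestronglyMeasurable
      · exact Eventually.of_forall fun n => Eventually.of_forall fun t _ => (hM _ t).2.1
      · simp
      · exact Eventually.of_forall fun t _ => lA1 t
    refine (cA.add h1).congr fun n => ?_
    rw [← (H (φ n)).hA.2]
    ring
  set cn : ℕ → ℝ := fun n => (p (φ n)).J k g
    - (2 * (∫ x, w x * (p (φ n)).u x) - ∫ x, w x ^ 2) / 2
    - k * (2 * (∫ x, z x * (p (φ n)).v x) - ∫ x, z x ^ 2) with hcn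
  have hWn : ∀ n, ∫ x, Wp g ((p (φ n)).A x) ((p (φ n)).B x) ≤ cn n := by
    intro n
    have h1 := (H (φ n)).J_eq k
    have h2 := weak_lower (H (φ n)).memu hw
    have h3 := mul_le_mul_of_nonneg_left (weak_lower (H (φ n)).memv hz) hk.le
    simp only [hcn]
    linarith
  have hcl : Tendsto cn atTop (𝓝 (m - (∫ x, w x ^ 2) / 2 - k * ∫ x, z x ^ 2)) := by
    have h1 := ((hm.comp hφm.tendsto_atTop).sub
      ((((wu w hw).const_mul 2).sub_const (∫ x, w x ^ 2)).div_const 2)).sub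
      ((((wv z hz).const_mul 2).sub_const (∫ x, z x ^ 2)).const_mul k)
    convert! h1 using 2
    have e1 : ∫ x, w x * w x = ∫ x, w x ^ 2 := by congr 1; funext x; ring
    have e2 : ∫ x, z x * z x = ∫ x, z x ^ 2 := by congr 1; funext x; ring
    rw [e1, e2]
    ring
  set cc := m - (∫ x, w x ^ 2) / 2 - k * ∫ x, z x ^ 2 with hcc
  have hcc0 : 0 ≤ cc := by
    refine ge_of_tendsto' hcl fun n => le_trans ?_ (hWn n)
    exact integral_nonneg fun x => Wp_nonneg hg _ _
  have hWc : Continuous fun x => Wp g (qA x) (qB x) := by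
    have h1 := PA.cont
    have h2 := PB.cont
    unfold Wp
    fun_prop
  have hfat : ∫⁻ x, ENNReal.ofReal (Wp g (qA x) (qB x)) ≤ ENNReal.ofReal cc := by
    have hpt : ∀ x, ENNReal.ofReal (Wp g (qA x) (qB x)) =
        liminf (fun n => ENNReal.ofReal (Wp g ((p (φ n)).A x) ((p (φ n)).B x))) atTop := by
      intro x
      have h1 : Tendsto (fun n => Wp g ((p (φ n)).A x) ((p (φ n)).B x)) atTop
          (𝓝 (Wp g (qA x) (qB x))) :=
        Wp_tendsto g (lA x) (lB x)
      exact ((ENNReal.continuous_ofReal.tendsto _).comp h1).liminf_eq.symm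
    simp only [hpt]
    refine (lintegral_liminf_le fun n => ?_).trans ?_
    · exact (H _).Wcont.measurable.ennreal_ofReal
    · have h2 : Tendsto (fun n => ENNReal.ofReal (cn n)) atTop (𝓝 (ENNReal.ofReal cc)) :=
        (ENNReal.continuous_ofReal.tendsto _).comp hcl
      rw [← h2.liminf_eq]
      apply liminf_le_liminf
      · refine Eventually.of_forall fun n => ?_
        rw [← ofReal_integral_eq_lintegral_ofReal (H _).hW
          (Eventually.of_forall fun x => Wp_nonneg hg _ _)]
        exact ENNReal.ofReal_le_ofReal (hWn n)
      · isBoundedDefault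
      · isBoundedDefault
  have hWint : Integrable fun x => Wp g (qA x) (qB x) := by
    refine ⟨hWc.aestronglyMeasurable, ?_⟩
    rw [hasFiniteIntegral_iff_ofReal (Eventually.of_forall fun x => Wp_nonneg hg _ _)]
    exact hfat.trans_lt ENNReal.ofReal_lt_top
  have hWle : ∫ x, Wp g (qA x) (qB x) ≤ cc := by
    rw [← ofReal_integral_eq_lintegral_ofReal hWint
          (Eventually.of_forall fun x => Wp_nonneg hg _ _)] at hfat
    exact (ENNReal.ofReal_le_ofReal_iff hcc0).1 hfat
  have Hq : Adm g ⟨qA, qA1, w, qB, z⟩ := ⟨PA, PA1, PB, hw.integrable_sq, hz.integrable_sq, hWint⟩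
  refine ⟨φ, hφm, ⟨qA, qA1, w, qB, z⟩, Hq, ?_, lA, lA1, lB⟩
  rw [Hq.J_eq k]
  simp only [hcc] at hWle
  linarith


/-! ### Existence of a minimizer -/

theorem seg_le {f w : ℝ → ℝ} (hf : Integrable f) (hw : Integrable w) (h0 : ∀ x, 0 ≤ w x)
    (hwf : ∀ x, w x ≤ f x) {S : Set ℝ} (hS : MeasurableSet S) (hd : Disjoint S (Ioc (-1) 1)) :
    (∫ x in S, f x) + ∫ x in (-1:ℝ)..1, w x ≤ ∫ x, f x := by
  rw [intervalIntegral.integral_of_le (by norm_num)]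
  have h1 : ∫ x in Ioc (-1:ℝ) 1, w x ≤ ∫ x in Ioc (-1:ℝ) 1, f x :=
    integral_mono hw.integrableOn hf.integrableOn hwf
  have h2 := setIntegral_union hd measurableSet_Ioc hf.integrableOn hf.integrableOn
  have h3 : ∫ x in S ∪ Ioc (-1) 1, f x ≤ ∫ x, f x :=
    setIntegral_le_integral hf (Eventually.of_forall fun x => (h0 x).trans (hwf x))
  linarith

theorem Wp_le_dens {k g : ℝ} (hk : 0 < k) (p : Pth) (x : ℝ) :
    Wp g (p.A x) (p.B x) ≤ p.dens k g x := by
  unfold Pth.dens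
  have : 0 ≤ p.u x ^ 2 / 2 + k * p.v x ^ 2 := by positivity
  linarith

theorem Conn.shift {g : ℝ} {p : Pth} (H : Conn g p) (c : ℝ) : Conn g (p.shift c) where
  adm := H.adm.shift c
  bot := H.bot.comp (tendsto_atBot_add_const_right atBot c tendsto_id)
  top := H.top.comp (tendsto_atTop_add_const_right atTop c tendsto_id)

theorem Conn.exists_zero {g : ℝ} {p : Pth} (H : Conn g p) :
    ∃ c, p.A c ^ 2 - p.B c ^ 2 = 0 := by
  have h1 := H.adm.hA.cont
  have h2 := H.adm.hB.cont
  obtain ⟨x, hx⟩ := (H.bot.eventually (lt_mem_nhds (show (0:ℝ) < 1 by norm_num))).exists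
  obtain ⟨y, hy⟩ := (H.top.eventually (gt_mem_nhds (show (-1:ℝ) < 0 by norm_num))).exists
  exact mem_range_of_exists_le_of_exists_ge
    (show Continuous fun x => p.A x ^ 2 - p.B x ^ 2 by fun_prop) ⟨y, hy.le⟩ ⟨x, hx.le⟩

theorem exists_min {k g : ℝ} (hk : 0 < k) (hg : 1 < g) (hne : ∃ p, Conn g p) :
    ∃ q, Conn g q ∧ q.J k g ≤ infJ k g := by
  obtain ⟨p0, hp0⟩ := hne
  obtain ⟨e, -, he, hmem⟩ := exists_seq_tendsto_sInf
    (S := {e | ∃ p, Conn g p ∧ e = p.J k g}) ⟨_, p0, hp0, rfl⟩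
    ⟨0, by rintro e ⟨q, -, rfl⟩; exact q.J_nonneg hk hg.le⟩
  choose r hr hre using hmem
  choose c hc using fun n => (hr n).exists_zero
  set p : ℕ → Pth := fun n => (r n).shift (c n) with hp
  have hC : ∀ n, Conn g (p n) := fun n => (hr n).shift (c n)
  have hJ : Tendsto (fun n => (p n).J k g) atTop (𝓝 (infJ k g)) := by
    refine he.congr fun n => ?_
    rw [hre, hp, Pth.J_shift]
  have hz : ∀ n, (p n).A 0 ^ 2 - (p n).B 0 ^ 2 = 0 := by
    intro n
    simp only [hp, Pth.shift, zero_add]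
    exact hc n
  obtain ⟨K, hK⟩ := hJ.bddAbove_range
  replace hK : ∀ n, (p n).J k g ≤ K := fun n => hK ⟨n, rfl⟩
  obtain ⟨M, hM0, hM⟩ := path_bound k K hk
  have hM : ∀ n x, |(p n).A x| ≤ M ∧ |(p n).A1 x| ≤ M ∧ |(p n).B x| ≤ M :=
    fun n => hM g hg.le (p n) (hC n).adm (hK n)
  obtain ⟨φ, hφ, q, hq, hqJ, lA, lA1, lB⟩ := path_compact hk hg.le p (fun n => (hC n).adm) _ hJ
  have hJφ := hJ.comp hφ.tendsto_atTop
  have hq0 : q.A 0 ^ 2 - q.B 0 ^ 2 = 0 := by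
    have := ((lA 0).pow 2).sub ((lB 0).pow 2)
    simp only [hz] at this
    exact (tendsto_nhds_unique this tendsto_const_nhds)
  have hWpos : 0 < Wp g (q.A 0) (q.B 0) := by
    have e : q.B 0 ^ 2 = q.A 0 ^ 2 := by linarith
    unfold Wp
    rw [e]
    have hg0 : 0 < g - 1 := by linarith
    rcases eq_or_ne (q.A 0) 0 with h | h
    · rw [h]; norm_num
    · have : 0 < q.A 0 ^ 2 := by positivity
      positivity
  set c0 := ∫ x in (-1:ℝ)..1, Wp g (q.A x) (q.B x) with hc0
  have hc0pos : 0 < c0 := by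
    apply intervalIntegral.integral_pos (by norm_num) hq.Wcont.continuousOn
      (fun x _ => Wp_nonneg hg.le _ _)
    exact ⟨0, by constructor <;> norm_num, hWpos⟩
  have hI : Tendsto (fun n => ∫ x in (-1:ℝ)..1, Wp g ((p (φ n)).A x) ((p (φ n)).B x)) atTop
      (𝓝 c0) := by
    obtain ⟨C, hCb⟩ := (isCompact_Icc (a := -M) (b := M)).prod
      (isCompact_Icc (a := -M) (b := M)) |>.exists_bound_of_continuousOn (Wp_cont g).continuousOn
    apply intervalIntegral.tendsto_integral_filter_of_dominated_convergence (fun _ => C)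
    · exact Eventually.of_forall fun n => (hC _).adm.Wcont.aestronglyMeasurable
    · refine Eventually.of_forall fun n => Eventually.of_forall fun t _ => ?_
      exact hCb ((p (φ n)).A t, (p (φ n)).B t) ⟨abs_le.1 (hM _ t).1, abs_le.1 (hM _ t).2.2⟩
    · simp
    · exact Eventually.of_forall fun t _ => Wp_tendsto g (lA t) (lB t)
  have htop : Tendsto (fun x => q.A x ^ 2 - q.B x ^ 2) atTop (𝓝 (-1)) := by
    obtain ⟨σ, τ, hE, hA, hA1, hB⟩ := path_limit hk hg hq
    rcases hE with ⟨h1, h2⟩ | ⟨h1, h2⟩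
    · exfalso
      obtain ⟨Φ, hΦ, hΦ0, hcut⟩ := cut_left hk hg.le h1 h2
      have hlim : Tendsto (fun x => Φ (q.A x - σ, - q.A1 x, q.B x - τ)) atTop (𝓝 0) := by
        rw [← hΦ0]
        refine (hΦ.tendsto 0).comp ?_
        have t1 := hA.sub_const σ
        have t2 := hA1.neg
        have t3 := hB.sub_const τ
        rw [sub_self] at t1 t3
        rw [neg_zero] at t2
        exact t1.prodMk_nhds (t2.prodMk_nhds t3)
      obtain ⟨x0, hx0, hx1⟩ := ((hlim.eventually (gt_mem_nhds hc0pos)).and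
        (eventually_ge_atTop 1)).exists
      have hle : ∀ n, infJ k g ≤ (p (φ n)).J k g
          - (∫ x in (-1:ℝ)..1, Wp g ((p (φ n)).A x) ((p (φ n)).B x))
          + Φ ((p (φ n)).A x0 - σ, - (p (φ n)).A1 x0, (p (φ n)).B x0 - τ) := by
        intro n
        have i1 := hcut _ (hC (φ n)) x0
        have i2 := seg_le ((hC (φ n)).adm.dens_int k) (hC (φ n)).adm.hW
          (fun x => Wp_nonneg hg.le _ _) (fun x => Wp_le_dens hk _ x)
          (measurableSet_Ioi (a := x0)) (by
            rw [Set.disjoint_left]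
            intro t ht ht2
            have := mem_Ioi.1 ht
            linarith [ht2.2])
        unfold Pth.J
        linarith
      have hl : Tendsto (fun n => (p (φ n)).J k g
          - (∫ x in (-1:ℝ)..1, Wp g ((p (φ n)).A x) ((p (φ n)).B x))
          + Φ ((p (φ n)).A x0 - σ, - (p (φ n)).A1 x0, (p (φ n)).B x0 - τ)) atTop
          (𝓝 (infJ k g - c0 + Φ (q.A x0 - σ, - q.A1 x0, q.B x0 - τ))) := by
        refine (hJφ.sub hI).add ((hΦ.tendsto _).comp ?_)
        exact ((lA x0).sub_const σ).prodMk_nhds ((lA1 x0).neg.prodMk_nhds ((lB x0).sub_const τ))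
      have := ge_of_tendsto' hl hle
      linarith
    · have := (hA.pow 2).sub (hB.pow 2)
      rw [h1, h2] at this
      simpa using this
  have hbot : Tendsto (fun x => q.A x ^ 2 - q.B x ^ 2) atBot (𝓝 1) := by
    obtain ⟨σ, τ, hE, hA, hA1, hB⟩ := path_limit hk hg hq.refl
    rcases hE with ⟨h1, h2⟩ | ⟨h1, h2⟩
    · have := (hA.pow 2).sub (hB.pow 2)
      rw [h1, h2] at this
      have := this.comp tendsto_neg_atBot_atTop
      simpa [Function.comp_def, Pth.refl] using this
    · exfalso
      obtain ⟨Φ, hΦ, hΦ0, hcut⟩ := cut_right hk hg.le h1 h2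
      have hlim : Tendsto (fun x => Φ (q.A (-x) - σ, q.A1 (-x), q.B (-x) - τ)) atTop (𝓝 0) := by
        rw [← hΦ0]
        refine (hΦ.tendsto 0).comp ?_
        have t1 := hA.sub_const σ
        have t2 := hA1.neg
        have t3 := hB.sub_const τ
        rw [sub_self] at t1 t3
        simp only [neg_zero, Pth.refl, neg_neg] at t1 t2 t3
        exact t1.prodMk_nhds (t2.prodMk_nhds t3)
      obtain ⟨y0, hx0, hx1⟩ := ((hlim.eventually (gt_mem_nhds hc0pos)).and
        (eventually_ge_atTop 1)).exists
      set x0 := -y0 with hxy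
      have hle : ∀ n, infJ k g ≤ (p (φ n)).J k g
          - (∫ x in (-1:ℝ)..1, Wp g ((p (φ n)).A x) ((p (φ n)).B x))
          + Φ ((p (φ n)).A x0 - σ, (p (φ n)).A1 x0, (p (φ n)).B x0 - τ) := by
        intro n
        have i1 := hcut _ (hC (φ n)) x0
        have i2 := seg_le ((hC (φ n)).adm.dens_int k) (hC (φ n)).adm.hW
          (fun x => Wp_nonneg hg.le _ _) (fun x => Wp_le_dens hk _ x)
          (measurableSet_Iic (a := x0)) (by
            rw [Set.disjoint_left]
            intro t ht ht2
            have := mem_Iic.1 ht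
            linarith [ht2.1])
        unfold Pth.J
        linarith
      have hl : Tendsto (fun n => (p (φ n)).J k g
          - (∫ x in (-1:ℝ)..1, Wp g ((p (φ n)).A x) ((p (φ n)).B x))
          + Φ ((p (φ n)).A x0 - σ, (p (φ n)).A1 x0, (p (φ n)).B x0 - τ)) atTop
          (𝓝 (infJ k g - c0 + Φ (q.A x0 - σ, q.A1 x0, q.B x0 - τ))) := by
        refine (hJφ.sub hI).add ((hΦ.tendsto _).comp ?_)
        exact ((lA x0).sub_const σ).prodMk_nhds ((lA1 x0).prodMk_nhds ((lB x0).sub_const τ))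
      have := ge_of_tendsto' hl hle
      linarith
  exact ⟨q, ⟨hq, hbot, htop⟩, hqJ⟩


/-! ### Du Bois-Reymond lemmas -/

/-- Test functions. -/
structure Tst (φ : ℝ → ℝ) : Prop where
  sm : ContDiff ℝ (⊤ : ℕ∞) φ
  cs : HasCompactSupport φ

namespace Tst

variable {φ ψ : ℝ → ℝ}

theorem der (H : Tst φ) : Tst (deriv φ) :=
  ⟨(contDiff_infty_iff_deriv.1 H.sm).2, H.cs.deriv⟩

theorem hasDer (H : Tst φ) (x : ℝ) : HasDerivAt φ (deriv φ x) x :=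
  ((contDiff_infty_iff_deriv.1 H.sm).1 x).hasDerivAt

theorem cont (H : Tst φ) : Continuous φ := H.sm.continuous

theorem sub_smul (H : Tst φ) (K : Tst ψ) (c : ℝ) : Tst (fun x => φ x - c * ψ x) :=
  ⟨H.sm.sub (contDiff_const.mul K.sm), by
    apply HasCompactSupport.sub H.cs
    exact K.cs.mul_left⟩

theorem intble (H : Tst φ) : Integrable φ := H.cont.integrable_of_hasCompactSupport H.cs

theorem mul_int (H : Tst φ) {h : ℝ → ℝ} (hh : LocallyIntegrable h volume) :
    Integrable fun x => h x * φ x := by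
  have := hh.integrable_smul_left_of_hasCompactSupport H.cont H.cs
  refine this.congr (Eventually.of_forall fun x => ?_)
  simp [mul_comm]

theorem anti (H : Tst φ) (h0 : ∫ x, φ x = 0) : ∃ χ, Tst χ ∧ deriv χ = φ := by
  obtain ⟨R, hR⟩ := H.cs.isCompact.isBounded.subset_closedBall 0
  have hz : ∀ x, R < |x| → φ x = 0 := by
    intro x hx
    by_contra hne
    have : x ∈ Metric.closedBall (0:ℝ) R := hR (subset_tsupport _ hne)
    simp at this
    linarith
  have hd : ∀ x, HasDerivAt (fun x => ∫ t in (-(|R|+1))..x, φ t) (φ x) x := fun x =>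
    intervalIntegral.integral_hasDerivAt_right (H.cont.intervalIntegrable _ _)
      H.cont.stronglyMeasurable.stronglyMeasurableAtFilter H.cont.continuousAt
  have hde : deriv (fun x => ∫ t in (-(|R|+1))..x, φ t) = φ := funext fun x => (hd x).deriv
  refine ⟨fun x => ∫ t in (-(|R|+1))..x, φ t, ⟨?_, ?_⟩, hde⟩
  · rw [contDiff_infty_iff_deriv]
    exact ⟨fun x => (hd x).differentiableAt, by rw [hde]; exact H.sm⟩
  · apply HasCompactSupport.intro (isCompact_Icc (a := -(|R|+1)) (b := |R|+1))
    intro x hx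
    have hle := le_abs_self R
    rw [mem_Icc, not_and_or] at hx
    rcases hx with hx | hx
    · push Not at hx
      apply intervalIntegral.integral_zero_ae
      refine Eventually.of_forall fun t ht => ?_
      rw [uIoc_of_ge hx.le, mem_Ioc] at ht
      apply hz
      rw [abs_of_neg (by have := abs_nonneg R; linarith [ht.2])]
      linarith [ht.2]
    · push Not at hx
      rw [intervalIntegral.integral_eq_integral_of_support_subset, h0]
      intro t ht
      have : |t| ≤ R := by
        by_contra hc
        exact ht (hz t (by linarith))
      have := abs_le.1 this
      constructor <;> linarith

end Tst

theorem exists_rho : ∃ ρ, Tst ρ ∧ ∫ x, ρ x = 1 := by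
  let b : ContDiffBump (0:ℝ) := ⟨1, 2, by norm_num, by norm_num⟩
  exact ⟨b.normed volume, ⟨b.contDiff_normed, b.hasCompactSupport_normed⟩, b.integral_normed⟩

theorem dbr1 {h : ℝ → ℝ} (hh : LocallyIntegrable h volume)
    (H : ∀ ψ, Tst ψ → ∫ x, h x * deriv ψ x = 0) : ∃ c, h =ᵐ[volume] fun _ => c := by
  obtain ⟨ρ, hρ, hρ1⟩ := exists_rho
  refine ⟨∫ x, h x * ρ x, ?_⟩
  set c := ∫ x, h x * ρ x with hc
  have hl : LocallyIntegrable (fun x => h x - c) volume := hh.sub (locallyIntegrable_const c)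
  have := ae_eq_zero_of_integral_contDiff_smul_eq_zero hl (μ := volume) ?_
  · filter_upwards [this] with x hx
    linarith
  · intro θ hθ hθc
    have T : Tst θ := ⟨hθ, hθc⟩
    obtain ⟨χ, hχ, hχd⟩ := (T.sub_smul hρ (∫ x, θ x)).anti (by
      rw [integral_sub T.intble (hρ.intble.const_mul _), integral_const_mul, hρ1]
      ring)
    have h1 := H χ hχ
    rw [hχd] at h1
    have e : ∀ x, h x * (θ x - (∫ x, θ x) * ρ x) = h x * θ x - (∫ x, θ x) * (h x * ρ x) :=
      fun x => by ring
    simp only [e] at h1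
    rw [integral_sub (T.mul_int hh) ((hρ.mul_int hh).const_mul _), integral_const_mul, ← hc] at h1
    have e2 : ∀ x, θ x • (h x - c) = h x * θ x - c * θ x := fun x => by
      simp only [smul_eq_mul]; ring
    simp only [e2]
    rw [integral_sub (T.mul_int hh) (T.intble.const_mul _), integral_const_mul]
    linarith

theorem ibp {F f φ : ℝ → ℝ} (hf : Continuous f) (hF : ∀ x, HasDerivAt F (f x) x) (T : Tst φ) :
    ∫ x, f x * φ x = - ∫ x, F x * deriv φ x := by
  have hFc : Continuous F := continuous_iff_continuousAt.2 fun x => (hF x).continuousAt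
  have := integral_mul_deriv_eq_deriv_mul_of_integrable (u := F) (v := φ) (u' := f)
    (v' := deriv φ) (fun x _ => hF x) (fun x _ => T.hasDer x)
    (T.der.mul_int hFc.locallyIntegrable) (T.mul_int hf.locallyIntegrable)
    (T.mul_int hFc.locallyIntegrable)
  linarith

theorem dbr2 {h : ℝ → ℝ} (hh : LocallyIntegrable h volume)
    (H : ∀ ψ, Tst ψ → ∫ x, h x * deriv (deriv ψ) x = 0) :
    ∃ c d : ℝ, h =ᵐ[volume] fun x => c + d * x := by
  obtain ⟨ρ, hρ, hρ1⟩ := exists_rho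
  set d := ∫ x, h x * deriv ρ x with hd
  have hl : LocallyIntegrable (fun x => h x + d * x) volume :=
    hh.add (by fun_prop : Continuous fun x : ℝ => d * x).locallyIntegrable
  obtain ⟨c, hc⟩ := dbr1 hl (fun ψ T => by
    obtain ⟨χ, hχ, hχd⟩ := (T.sub_smul hρ (∫ x, ψ x)).anti (by
      rw [integral_sub T.intble (hρ.intble.const_mul _), integral_const_mul, hρ1]
      ring)
    have h1 := H χ hχ
    have hdd : ∀ x, deriv (deriv χ) x = deriv ψ x - (∫ x, ψ x) * deriv ρ x := by
      intro x
      rw [hχd]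
      exact ((T.hasDer x).sub ((hρ.hasDer x).const_mul _)).deriv
    have e : ∀ x, h x * deriv (deriv χ) x
        = h x * deriv ψ x - (∫ x, ψ x) * (h x * deriv ρ x) := fun x => by rw [hdd]; ring
    simp only [e] at h1
    rw [integral_sub (T.der.mul_int hh) ((hρ.der.mul_int hh).const_mul _), integral_const_mul,
      ← hd] at h1
    have h2 := ibp (F := fun x => d * x) (f := fun _ => d) continuous_const
      (fun x => by simpa using (hasDerivAt_id x).const_mul d) T
    rw [integral_const_mul] at h2
    have e2 : ∀ x, (h x + d * x) * deriv ψ x = h x * deriv ψ x + d * x * deriv ψ x :=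
      fun x => by ring
    simp only [e2]
    rw [integral_add (T.der.mul_int hh)
      (T.der.mul_int (by fun_prop : Continuous fun x : ℝ => d * x).locallyIntegrable)]
    linarith)
  refine ⟨c, -d, ?_⟩
  filter_upwards [hc] with x hx
  linarith

/-! ### First variation -/

theorem quartic_zero {c1 c2 c3 c4 : ℝ}
    (h : ∀ s : ℝ, 0 ≤ s * c1 + s ^ 2 * c2 + s ^ 3 * c3 + s ^ 4 * c4) : c1 = 0 := by
  have hd : HasDerivAt (fun s : ℝ => s * c1 + s ^ 2 * c2 + s ^ 3 * c3 + s ^ 4 * c4) c1 0 := by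
    have := ((((hasDerivAt_id (0:ℝ)).mul_const c1).add ((hasDerivAt_pow 2 (0:ℝ)).mul_const c2)).add
      ((hasDerivAt_pow 3 (0:ℝ)).mul_const c3)).add ((hasDerivAt_pow 4 (0:ℝ)).mul_const c4)
    exact this.congr_deriv (by simp)
  refine IsLocalMin.hasDerivAt_eq_zero (f := fun s : ℝ => s * c1 + s ^ 2 * c2 + s ^ 3 * c3 + s ^ 4 * c4)
    (a := 0) ?_ hd
  refine Eventually.of_forall fun s => ?_
  simpa using h s

theorem poly_var {D1 D2 D3 D4 : ℝ → ℝ} (i1 : Integrable D1) (i2 : Integrable D2)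
    (i3 : Integrable D3) (i4 : Integrable D4)
    (h : ∀ s : ℝ, 0 ≤ ∫ x, (s * D1 x + s ^ 2 * D2 x + s ^ 3 * D3 x + s ^ 4 * D4 x)) :
    ∫ x, D1 x = 0 := by
  refine quartic_zero (c2 := ∫ x, D2 x) (c3 := ∫ x, D3 x) (c4 := ∫ x, D4 x) fun s => ?_
  have j1 : Integrable fun x => s * D1 x := i1.const_mul s
  have j2 : Integrable fun x => s ^ 2 * D2 x := i2.const_mul _
  have j3 : Integrable fun x => s ^ 3 * D3 x := i3.const_mul _
  have j4 : Integrable fun x => s ^ 4 * D4 x := i4.const_mul _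
  have j12 : Integrable fun x => s * D1 x + s ^ 2 * D2 x := j1.add j2
  have j123 : Integrable fun x => s * D1 x + s ^ 2 * D2 x + s ^ 3 * D3 x := j12.add j3
  have := h s
  rw [integral_add j123 j4, integral_add j12 j3, integral_add j1 j2] at this
  simpa only [integral_const_mul] using this

/-- Perturbed path. -/
noncomputable def Pth.var (q : Pth) (φ ψ : ℝ → ℝ) (s : ℝ) : Pth :=
  ⟨fun x => q.A x + s * φ x, fun x => q.A1 x + s * deriv φ x,
    fun x => q.u x + s * deriv (deriv φ) x, fun x => q.B x + s * ψ x,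
    fun x => q.v x + s * deriv ψ x⟩

theorem Tst.prim {φ : ℝ → ℝ} (T : Tst φ) : Prim φ (deriv φ) :=
  Prim.of_hasDerivAt T.der.cont T.hasDer

theorem cs_int {f : ℝ → ℝ} {K : Set ℝ} (hK : IsCompact K) (hf : Continuous f)
    (h : ∀ x, x ∉ K → f x = 0) : Integrable f :=
  hf.integrable_of_hasCompactSupport (HasCompactSupport.intro hK h)

theorem Tst.vanish {φ : ℝ → ℝ} {x : ℝ} (hx : x ∉ tsupport φ) :
    φ x = 0 ∧ deriv φ x = 0 ∧ deriv (deriv φ) x = 0 := by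
  have h1 : x ∉ tsupport (deriv φ) := fun h => hx (tsupport_deriv_subset h)
  have h2 : x ∉ tsupport (deriv (deriv φ)) := fun h => h1 (tsupport_deriv_subset h)
  exact ⟨image_eq_zero_of_notMem_tsupport hx, image_eq_zero_of_notMem_tsupport h1,
    image_eq_zero_of_notMem_tsupport h2⟩

theorem var_conn {g : ℝ} {q : Pth} (H : Conn g q) {φ ψ : ℝ → ℝ} (T : Tst φ) (S : Tst ψ) (s : ℝ) :
    Conn g (q.var φ ψ s) := by
  have hK : IsCompact (tsupport φ ∪ tsupport ψ) := T.cs.isCompact.union S.cs.isCompact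
  have hv : ∀ x, x ∉ tsupport φ ∪ tsupport ψ → φ x = 0 ∧ ψ x = 0 := fun x hx => by
    rw [mem_union, not_or] at hx
    exact ⟨(Tst.vanish hx.1).1, (Tst.vanish hx.2).1⟩
  have hco : ∀ᶠ x in cocompact ℝ, x ∉ tsupport φ ∪ tsupport ψ := hK.compl_mem_cocompact
  have hev : ∀ᶠ x in cocompact ℝ, q.A x ^ 2 - q.B x ^ 2
      = (q.var φ ψ s).A x ^ 2 - (q.var φ ψ s).B x ^ 2 := by
    filter_upwards [hco] with x hx
    simp [Pth.var, hv x hx]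
  have hAc := H.adm.hA.cont
  have hBc := H.adm.hB.cont
  have hTc := T.cont
  have hSc := S.cont
  refine ⟨⟨?_, ?_, ?_, ?_, ?_, ?_⟩, ?_, ?_⟩
  · exact H.adm.hA.add (T.prim.smul s)
  · exact H.adm.hA1.add (T.der.prim.smul s)
  · exact H.adm.hB.add (S.prim.smul s)
  · have h1 := (T.der.der.mul_int H.adm.hA1.1).const_mul (2 * s)
    have h2 : Integrable fun x => s ^ 2 * (deriv (deriv φ) x * deriv (deriv φ) x) :=
      (T.der.der.mul_int T.der.der.cont.locallyIntegrable).const_mul (s ^ 2)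
    refine ((H.adm.hu.add h1).add h2).congr (Eventually.of_forall fun x => ?_)
    simp only [Pth.var, Pi.add_apply]
    ring
  · have h1 := (S.der.mul_int H.adm.hB.1).const_mul (2 * s)
    have h2 : Integrable fun x => s ^ 2 * (deriv ψ x * deriv ψ x) :=
      (S.der.mul_int S.der.cont.locallyIntegrable).const_mul (s ^ 2)
    refine ((H.adm.hv.add h1).add h2).congr (Eventually.of_forall fun x => ?_)
    simp only [Pth.var, Pi.add_apply]
    ring
  · have h1 : Integrable fun x => Wp g (q.A x + s * φ x) (q.B x + s * ψ x) - Wp g (q.A x) (q.B x) := by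
      apply cs_int hK
      · unfold Wp
        fun_prop
      · intro x hx
        simp [hv x hx]
    refine (H.adm.hW.add h1).congr (Eventually.of_forall fun x => ?_)
    simp [Pth.var]
  · exact H.bot.congr' (hev.filter_mono _root_.atBot_le_cocompact)
  · exact H.top.congr' (hev.filter_mono _root_.atTop_le_cocompact)

theorem first_var {k g : ℝ} (hk : 0 < k) (hg : 1 ≤ g) {q : Pth} (H : Conn g q)
    (hm : q.J k g ≤ infJ k g) {φ ψ : ℝ → ℝ} (T : Tst φ) (S : Tst ψ) :
    ∫ x, (q.u x * deriv (deriv φ) x + 2 * k * (q.v x * deriv ψ x)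
      + q.A x * (q.A x ^ 2 + g * q.B x ^ 2 - 1) * φ x
      + q.B x * (g * q.A x ^ 2 + q.B x ^ 2 - 1) * ψ x) = 0 := by
  have hK : IsCompact (tsupport φ ∪ tsupport ψ) := T.cs.isCompact.union S.cs.isCompact
  have hv : ∀ x, x ∉ tsupport φ ∪ tsupport ψ → φ x = 0 ∧ ψ x = 0 ∧ deriv (deriv φ) x = 0 ∧
      deriv ψ x = 0 := fun x hx => by
    rw [mem_union, not_or] at hx
    exact ⟨(Tst.vanish hx.1).1, (Tst.vanish hx.2).1, (Tst.vanish hx.1).2.2, (Tst.vanish hx.2).2.1⟩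
  have hAc := H.adm.hA.cont
  have hBc := H.adm.hB.cont
  have hTc := T.cont
  have hSc := S.cont
  have hT2 := T.der.der.cont
  have hS1 := S.der.cont
  have i1 : Integrable fun x => (q.u x * deriv (deriv φ) x + 2 * k * (q.v x * deriv ψ x)
      + q.A x * (q.A x ^ 2 + g * q.B x ^ 2 - 1) * φ x
      + q.B x * (g * q.A x ^ 2 + q.B x ^ 2 - 1) * ψ x) := by
    refine (((T.der.der.mul_int H.adm.hA1.1).add ((S.der.mul_int H.adm.hB.1).const_mul (2*k))).add
      ?_).add ?_
    · apply T.mul_int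
      apply Continuous.locallyIntegrable
      fun_prop
    · apply S.mul_int
      apply Continuous.locallyIntegrable
      fun_prop
  have i2 : Integrable fun x => (deriv (deriv φ) x ^ 2 / 2 + k * deriv ψ x ^ 2
      + ((2 * q.A x * φ x + 2 * q.B x * ψ x) ^ 2
        + 2 * (q.A x ^ 2 + q.B x ^ 2 - 1) * (φ x ^ 2 + ψ x ^ 2)) / 4
      + (g - 1) / 2 * ((q.A x * ψ x + q.B x * φ x) ^ 2 + 2 * (q.A x * q.B x) * (φ x * ψ x))) := by
    apply cs_int hK
    · fun_prop
    · intro x hx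
      simp [hv x hx]
  have i3 : Integrable fun x => ((2 * q.A x * φ x + 2 * q.B x * ψ x) * (φ x ^ 2 + ψ x ^ 2) / 2
      + (g - 1) * ((q.A x * ψ x + q.B x * φ x) * (φ x * ψ x))) := by
    apply cs_int hK
    · fun_prop
    · intro x hx
      simp [hv x hx]
  have i4 : Integrable fun x => ((φ x ^ 2 + ψ x ^ 2) ^ 2 / 4 + (g - 1) / 2 * (φ x * ψ x) ^ 2) := by
    apply cs_int hK
    · fun_prop
    · intro x hx
      simp [hv x hx]
  refine poly_var i1 i2 i3 i4 fun s => ?_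
  have hle : q.J k g ≤ (q.var φ ψ s).J k g := hm.trans (infJ_le hk hg (var_conn H T S s))
  have i0 := H.adm.dens_int k
  have e : (q.var φ ψ s).J k g - q.J k g = _ :=
    (integral_sub ((var_conn H T S s).adm.dens_int k) i0).symm
  refine (sub_nonneg.2 hle).trans_eq (e.trans (integral_congr_ae (Eventually.of_forall fun x => ?_)))
  simp only [Pth.dens, Pth.var, Wp]
  ring


/-! ### Regularity -/

theorem exists_anti {f : ℝ → ℝ} (hf : Continuous f) : ∃ F : ℝ → ℝ, ∀ x, HasDerivAt F (f x) x :=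
  ⟨fun x => ∫ t in (0:ℝ)..x, f t, fun _ =>
    intervalIntegral.integral_hasDerivAt_right (hf.intervalIntegrable _ _)
      hf.stronglyMeasurable.stronglyMeasurableAtFilter hf.continuousAt⟩

theorem cont_of_hasDeriv {F f : ℝ → ℝ} (h : ∀ x, HasDerivAt F (f x) x) : Continuous F :=
  continuous_iff_continuousAt.2 fun x => (h x).continuousAt

/-- Classical solutions. -/
structure Sol (k g : ℝ) (A A1 U A3 B V : ℝ → ℝ) : Prop where
  dA : ∀ x, HasDerivAt A (A1 x) x
  dA1 : ∀ x, HasDerivAt A1 (U x) x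
  dU : ∀ x, HasDerivAt U (A3 x) x
  dA3 : ∀ x, HasDerivAt A3 (-(A x * (A x ^ 2 + g * B x ^ 2 - 1))) x
  dB : ∀ x, HasDerivAt B (V x) x
  dV : ∀ x, HasDerivAt V (1 / (2 * k) * (B x * (g * A x ^ 2 + B x ^ 2 - 1))) x

theorem Tst.zero : Tst (fun _ => 0) := ⟨contDiff_const, HasCompactSupport.zero⟩

theorem regular {k g : ℝ} (hk : 0 < k) (hg : 1 ≤ g) {q : Pth} (H : Conn g q)
    (hm : q.J k g ≤ infJ k g) : ∃ U A3 V, Sol k g q.A q.A1 U A3 q.B V := by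
  have hAc := H.adm.hA.cont
  have hA1c := H.adm.hA1.cont
  have hBc := H.adm.hB.cont
  have hWA : Continuous fun x => q.A x * (q.A x ^ 2 + g * q.B x ^ 2 - 1) := by fun_prop
  have hWB : Continuous fun x => q.B x * (g * q.A x ^ 2 + q.B x ^ 2 - 1) := by fun_prop
  obtain ⟨F1, hF1⟩ := exists_anti hWA
  have hF1c := cont_of_hasDeriv hF1
  obtain ⟨F2, hF2⟩ := exists_anti hF1c
  have hF2c := cont_of_hasDeriv hF2
  obtain ⟨G1, hG1⟩ := exists_anti hWB
  have hG1c := cont_of_hasDeriv hG1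
  have d0 : deriv (fun _ : ℝ => (0:ℝ)) = fun _ => 0 := by funext x; simp
  obtain ⟨c, d, hcd⟩ := dbr2 (h := fun x => q.u x + F2 x)
    (H.adm.hA1.1.add hF2c.locallyIntegrable) (fun φ T => by
      have h1 := first_var hk hg H hm T Tst.zero
      simp only [d0, mul_zero, add_zero] at h1
      rw [integral_add (T.der.der.mul_int H.adm.hA1.1) (T.mul_int hWA.locallyIntegrable),
        ibp hWA hF1 T, ibp hF1c hF2 T.der, neg_neg] at h1
      simp only [add_mul]
      rw [integral_add (T.der.der.mul_int H.adm.hA1.1) (T.der.der.mul_int hF2c.locallyIntegrable)]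
      exact h1)
  obtain ⟨e, he⟩ := dbr1 (h := fun x => 2 * k * q.v x - G1 x)
    ((H.adm.hB.smul (2 * k)).1.sub hG1c.locallyIntegrable) (fun ψ T => by
      have h1 := first_var hk hg H hm Tst.zero T
      simp only [d0, mul_zero, add_zero, zero_add] at h1
      have j1 : Integrable fun x => 2 * k * (q.v x * deriv ψ x) :=
        (T.der.mul_int H.adm.hB.1).const_mul _
      rw [integral_add j1 (T.mul_int hWB.locallyIntegrable), ibp hWB hG1 T] at h1
      simp only [sub_mul, mul_assoc] at h1 ⊢
      simp only [mul_assoc] at j1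
      rw [integral_sub j1 (T.der.mul_int hG1c.locallyIntegrable)]
      linarith)
  have hU : Prim q.A1 (fun x => c + d * x - F2 x) := H.adm.hA1.congr_ae (by
    filter_upwards [hcd] with x hx
    linarith)
  have hV : Prim q.B (fun x => 1 / (2 * k) * (e + G1 x)) := H.adm.hB.congr_ae (by
    filter_upwards [he] with x hx
    field_simp
    linarith)
  refine ⟨fun x => c + d * x - F2 x, fun x => d - F1 x, fun x => 1 / (2 * k) * (e + G1 x),
    H.adm.hA.hasDerivAt hA1c, hU.hasDerivAt (by fun_prop), fun x => ?_, fun x => ?_,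
    hV.hasDerivAt (by fun_prop), fun x => ?_⟩
  · have := (((hasDerivAt_id x).const_mul d).const_add c).sub (hF2 x)
    exact this.congr_deriv (by simp)
  · exact (hF1 x).const_sub d
  · exact ((hG1 x).const_add e).const_mul _

section
variable {k g : ℝ} {A A1 U A3 B V : ℝ → ℝ}

theorem smooth_step {F f : ℝ → ℝ} (n : ℕ) (h : ∀ x, HasDerivAt F (f x) x)
    (hf : ContDiff ℝ n f) : ContDiff ℝ (n + 1 : ℕ) F := by
  push_cast
  rw [contDiff_succ_iff_deriv]
  refine ⟨fun x => (h x).differentiableAt, fun hn => by simp at hn, ?_⟩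
  rw [show deriv F = f from funext fun x => (h x).deriv]
  exact hf

theorem Sol.smooth (S : Sol k g A A1 U A3 B V) :
    ContDiff ℝ (⊤ : ℕ∞) A ∧ ContDiff ℝ (⊤ : ℕ∞) B := by
  have key : ∀ n : ℕ, ContDiff ℝ n A ∧ ContDiff ℝ n A1 ∧ ContDiff ℝ n U ∧ ContDiff ℝ n A3 ∧
      ContDiff ℝ n B ∧ ContDiff ℝ n V := by
    intro n
    induction n with
    | zero =>
      simp only [Nat.cast_zero, contDiff_zero]
      exact ⟨cont_of_hasDeriv S.dA, cont_of_hasDeriv S.dA1, cont_of_hasDeriv S.dU,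
        cont_of_hasDeriv S.dA3, cont_of_hasDeriv S.dB, cont_of_hasDeriv S.dV⟩
    | succ n ih =>
      obtain ⟨hA, hA1, hU, hA3, hB, hV⟩ := ih
      exact ⟨smooth_step n S.dA hA1, smooth_step n S.dA1 hU, smooth_step n S.dU hA3,
        smooth_step n S.dA3 (by fun_prop), smooth_step n S.dB hV, smooth_step n S.dV (by fun_prop)⟩
  exact ⟨contDiff_infty.2 fun n => (key n).1, contDiff_infty.2 fun n => (key n).2.2.2.2.1⟩

theorem Sol.eqA (S : Sol k g A A1 U A3 B V) (x : ℝ) :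
    iteratedDeriv 4 A x = A x * (1 - A x ^ 2 - g * B x ^ 2) := by
  have e1 : deriv A = A1 := funext fun x => (S.dA x).deriv
  have e2 : deriv A1 = U := funext fun x => (S.dA1 x).deriv
  have e3 : deriv U = A3 := funext fun x => (S.dU x).deriv
  rw [iteratedDeriv_succ', iteratedDeriv_succ', iteratedDeriv_succ', iteratedDeriv_one, e1, e2, e3,
    (S.dA3 x).deriv]
  ring

theorem Sol.eqB (S : Sol k g A A1 U A3 B V) (x : ℝ) :
    iteratedDeriv 2 B x = 1 / (2 * k) * (B x * (g * A x ^ 2 + B x ^ 2 - 1)) := by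
  have e1 : deriv B = V := funext fun x => (S.dB x).deriv
  rw [iteratedDeriv_succ', iteratedDeriv_one, e1, (S.dV x).deriv]

theorem Sol.B_zero (S : Sol k g A A1 U A3 B V) {M : ℝ} (hM : ∀ x, |A x| ≤ M ∧ |B x| ≤ M) {x0 : ℝ}
    (h0 : B x0 = 0) (h1 : V x0 = 0) (x : ℝ) : B x = 0 := by
  set c : ℝ → ℝ := fun x => 1 / (2 * k) * (g * A x ^ 2 + B x ^ 2 - 1) with hc
  obtain ⟨C, hC⟩ : ∃ C, ∀ x, |c x| ≤ C := by
    refine ⟨|1 / (2 * k)| * (|g| * M ^ 2 + M ^ 2 + 1), fun x => ?_⟩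
    simp only [hc]
    rw [abs_mul]
    refine mul_le_mul_of_nonneg_left ?_ (abs_nonneg _)
    have ha : |A x ^ 2| ≤ M ^ 2 := by
      rw [abs_pow]; exact pow_le_pow_left₀ (abs_nonneg _) (hM x).1 2
    have hb : |B x ^ 2| ≤ M ^ 2 := by
      rw [abs_pow]; exact pow_le_pow_left₀ (abs_nonneg _) (hM x).2 2
    have h3 : |g * A x ^ 2| ≤ |g| * M ^ 2 := by
      rw [abs_mul]; exact mul_le_mul_of_nonneg_left ha (abs_nonneg _)
    have h4 := abs_sub (g * A x ^ 2 + B x ^ 2) 1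
    have h5 := abs_add_le (g * A x ^ 2) (B x ^ 2)
    rw [abs_one] at h4
    linarith
  have hC0 : 0 ≤ C := (abs_nonneg _).trans (hC 0)
  have := ODE_solution_unique_univ (v := fun t (z : ℝ × ℝ) => (z.2, c t * z.1))
    (s := fun _ => univ) (K := ⟨max 1 C, by positivity⟩) (f := fun t => (B t, V t))
    (g := fun _ => 0) (t₀ := x0) (fun t => by
      apply LipschitzWith.lipschitzOnWith
      apply LipschitzWith.of_dist_le_mul
      intro z w
      simp only [Prod.dist_eq, Real.dist_eq]
      have hm := abs_nonneg (z.1 - w.1)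
      apply max_le
      · calc |z.2 - w.2| ≤ max |z.1 - w.1| |z.2 - w.2| := le_max_right _ _
          _ = 1 * max |z.1 - w.1| |z.2 - w.2| := (one_mul _).symm
          _ ≤ _ := mul_le_mul_of_nonneg_right (le_max_left _ _) (hm.trans (le_max_left _ _))
      · rw [← mul_sub, abs_mul]
        exact mul_le_mul ((hC t).trans (le_max_right _ _)) (le_max_left _ _) hm
          (zero_le_one.trans (le_max_left 1 C)))
    (fun t => ⟨by
      have := (S.dB t).prodMk (S.dV t)
      refine this.congr_deriv ?_
      simp only [hc]
      congr 1
      ring, mem_univ _⟩)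
    (fun t => ⟨by
      refine (hasDerivAt_const t (0 : ℝ × ℝ)).congr_deriv ?_
      simp only [Prod.fst_zero, Prod.snd_zero, mul_zero]
      rfl, mem_univ _⟩)
    (by simp [h0, h1])
  have h2 := congrFun this x
  exact congrArg Prod.fst h2
end

/-! ### Sign of the second component and the choice of the solution -/

/-- Flip the sign of the second component on a half line. -/
noncomputable def Pth.flip (q : Pth) (c : ℝ) : Pth :=
  ⟨q.A, q.A1, q.u, fun x => if x ≤ c then -q.B x else q.B x,
    fun x => if x ≤ c then -q.v x else q.v x⟩

/-- Change both signs. -/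
noncomputable def Pth.sgn (q : Pth) (σ τ : ℝ) : Pth :=
  ⟨fun x => σ * q.A x, fun x => σ * q.A1 x, fun x => σ * q.u x, fun x => τ * q.B x,
    fun x => τ * q.v x⟩

theorem Conn.of_sq {k g : ℝ} {q p : Pth} (H : Conn g q) (hA : Prim p.A p.A1) (hA1 : Prim p.A1 p.u)
    (hB : Prim p.B p.v) (h1 : ∀ x, p.A x ^ 2 = q.A x ^ 2) (h2 : ∀ x, p.u x ^ 2 = q.u x ^ 2)
    (h3 : ∀ x, p.B x ^ 2 = q.B x ^ 2) (h4 : ∀ x, p.v x ^ 2 = q.v x ^ 2) :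
    Conn g p ∧ p.J k g = q.J k g := by
  refine ⟨⟨⟨hA, hA1, hB, ?_, ?_, ?_⟩, ?_, ?_⟩, ?_⟩
  · simpa only [h2] using H.adm.hu
  · simpa only [h4] using H.adm.hv
  · simpa only [Wp, h1, h3] using H.adm.hW
  · simpa only [h1, h3] using H.bot
  · simpa only [h1, h3] using H.top
  · simp only [Pth.J, Pth.dens, Wp, h1, h2, h3, h4]

theorem min_B_ne {k g : ℝ} (hk : 0 < k) (hg : 1 < g) {q : Pth} (H : Conn g q)
    (hm : q.J k g ≤ infJ k g) (x0 : ℝ) : q.B x0 ≠ 0 := by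
  intro h0
  obtain ⟨U, A3, V, S⟩ := regular hk hg.le H hm
  obtain ⟨HF, hJ⟩ := H.of_sq (k := k) (p := q.flip x0) H.adm.hA H.adm.hA1
    (H.adm.hB.neg.glue H.adm.hB x0 (by simp [h0])) (fun x => rfl) (fun x => rfl)
    (fun x => by simp only [Pth.flip]; split_ifs <;> ring)
    (fun x => by simp only [Pth.flip]; split_ifs <;> ring)
  obtain ⟨U', A3', V', S'⟩ := regular hk hg.le HF (hJ.trans_le hm)
  have d := S'.dB x0
  have dr : V' x0 = V x0 := by
    refine (uniqueDiffWithinAt_Ici x0).eq_deriv _ d.hasDerivWithinAt ?_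
    refine (S.dB x0).hasDerivWithinAt.congr (fun x hx => ?_) ?_
    · simp only [Pth.flip]
      split_ifs with h
      · have : x = x0 := le_antisymm h hx
        rw [this, h0]
        simp
      · rfl
    · simp [Pth.flip, h0]
  have dl : V' x0 = - V x0 := by
    refine (uniqueDiffWithinAt_Iic x0).eq_deriv _ d.hasDerivWithinAt ?_
    refine (S.dB x0).neg.hasDerivWithinAt.congr (fun x hx => ?_) ?_
    · simp only [Pth.flip]
      rw [if_pos (mem_Iic.1 hx)]
      rfl
    · simp [Pth.flip, h0]
  have hV : V x0 = 0 := by linarith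
  obtain ⟨M, -, hM⟩ := path_bound k (infJ k g) hk
  have hz := S.B_zero (M := M) (fun x => ⟨(hM g hg.le q H.adm hm x).1, (hM g hg.le q H.adm hm x).2.2⟩)
    h0 hV
  have ht := H.top
  simp only [hz] at ht
  have := ge_of_tendsto' ht (b := 0) (fun x => by nlinarith [sq_nonneg (q.A x)])
  linarith

theorem sq_lim {a b : ℝ} (h : Eqm a b) : (a ^ 2 - b ^ 2 = 1 → a ^ 2 = 1 ∧ b = 0) ∧
    (a ^ 2 - b ^ 2 = -1 → a = 0 ∧ b ^ 2 = 1) := by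
  rcases h with ⟨h1, h2⟩ | ⟨h1, h2⟩
  · refine ⟨fun _ => ⟨h1, h2⟩, fun h => ?_⟩
    rw [h1, h2] at h
    norm_num at h
  · refine ⟨fun h => ?_, fun _ => ⟨h1, h2⟩⟩
    rw [h1, h2] at h
    norm_num at h

theorem Conn.limits {k g : ℝ} (hk : 0 < k) (hg : 1 < g) {q : Pth} (H : Conn g q) :
    (∃ σ, σ ^ 2 = 1 ∧ Tendsto q.A atBot (𝓝 σ) ∧ Tendsto q.B atBot (𝓝 0)) ∧
    (∃ τ, τ ^ 2 = 1 ∧ Tendsto q.A atTop (𝓝 0) ∧ Tendsto q.B atTop (𝓝 τ)) := by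
  constructor
  · obtain ⟨σ, τ, he, hA, -, hB⟩ := path_limit hk hg H.adm.refl
    have hA' : Tendsto q.A atBot (𝓝 σ) := by
      have := hA.comp tendsto_neg_atBot_atTop
      refine this.congr fun x => ?_
      simp [Pth.refl]
    have hB' : Tendsto q.B atBot (𝓝 τ) := by
      have := hB.comp tendsto_neg_atBot_atTop
      refine this.congr fun x => ?_
      simp [Pth.refl]
    have := tendsto_nhds_unique ((hA'.pow 2).sub (hB'.pow 2)) H.bot
    obtain ⟨h1, h2⟩ := (sq_lim he).1 this
    subst h2
    exact ⟨σ, h1, hA', hB'⟩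
  · obtain ⟨σ, τ, he, hA, -, hB⟩ := path_limit hk hg H.adm
    have := tendsto_nhds_unique ((hA.pow 2).sub (hB.pow 2)) H.top
    obtain ⟨h1, h2⟩ := (sq_lim he).2 this
    subst h1
    exact ⟨τ, h2, hA, hB⟩

theorem exists_good {k g : ℝ} (hk : 0 < k) (hg : 1 < g) (hne : ∃ p, Conn g p) :
    ∃ q, Conn g q ∧ q.J k g ≤ infJ k g ∧ Tendsto q.A atBot (𝓝 1) ∧ Tendsto q.B atBot (𝓝 0) ∧
      Tendsto q.A atTop (𝓝 0) ∧ Tendsto q.B atTop (𝓝 1) ∧ ∀ x, 0 ≤ q.B x := by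
  obtain ⟨q, H, hm⟩ := exists_min hk hg hne
  obtain ⟨⟨σ, hσ, a1, b1⟩, ⟨τ, hτ, a2, b2⟩⟩ := H.limits hk hg
  obtain ⟨HF, hJ⟩ := H.of_sq (k := k) (p := q.sgn σ τ) (H.adm.hA.smul σ) (H.adm.hA1.smul σ)
    (H.adm.hB.smul τ) (fun x => by simp [Pth.sgn, mul_pow, hσ])
    (fun x => by simp [Pth.sgn, mul_pow, hσ]) (fun x => by simp [Pth.sgn, mul_pow, hτ])
    (fun x => by simp [Pth.sgn, mul_pow, hτ])
  have hmin := hJ.trans_le hm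
  have b2' : Tendsto (q.sgn σ τ).B atTop (𝓝 1) := by
    have := b2.const_mul τ
    rwa [← sq, hτ] at this
  refine ⟨q.sgn σ τ, HF, hmin, ?_, ?_, ?_, b2', ?_⟩
  · have := a1.const_mul σ
    rwa [← sq, hσ] at this
  · simpa [Pth.sgn] using b1.const_mul τ
  · simpa [Pth.sgn] using a2.const_mul σ
  · intro x
    by_contra hx
    push Not at hx
    obtain ⟨y, hy⟩ := (b2'.eventually (lt_mem_nhds (zero_lt_one))).exists
    obtain ⟨z, hz⟩ := mem_range_of_exists_le_of_exists_ge HF.adm.hB.cont ⟨x, hx.le⟩ ⟨y, hy.le⟩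
    exact min_B_ne hk hg HF hmin z hz


/-! ### Test path -/

theorem exists_test : ∃ a b : ℝ → ℝ, ContDiff ℝ (⊤ : ℕ∞) a ∧ ContDiff ℝ (⊤ : ℕ∞) b ∧
    (∀ x, a x ^ 2 + b x ^ 2 = 1) ∧ (∀ x, x ≤ 0 → a x = 1 ∧ b x = 0) ∧
    (∀ x, 1 ≤ x → a x = 0 ∧ b x = 1) := by
  have hs : ContDiff ℝ (⊤ : ℕ∞) Real.smoothTransition := Real.smoothTransition.contDiff
  refine ⟨fun x => Real.cos (Real.pi / 2 * Real.smoothTransition x),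
    fun x => Real.sin (Real.pi / 2 * Real.smoothTransition x),
    Real.contDiff_cos.comp (contDiff_const.mul hs), Real.contDiff_sin.comp (contDiff_const.mul hs),
    fun x => by simp, fun x hx => ?_, fun x hx => ?_⟩
  · simp [Real.smoothTransition.zero_of_nonpos hx]
  · simp [Real.smoothTransition.one_of_one_le hx]

theorem deriv_off {a : ℝ → ℝ} {c d : ℝ} (h0 : ∀ x, x ≤ 0 → a x = c) (h1 : ∀ x, 1 ≤ x → a x = d)
    {x : ℝ} (hx : x ∉ Icc (0:ℝ) 1) : deriv a x = 0 ∧ deriv (deriv a) x = 0 := by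
  obtain ⟨e, he⟩ : ∃ e, a =ᶠ[𝓝 x] fun _ => e := by
    rw [mem_Icc, not_and_or] at hx
    rcases hx with hx | hx
    · push Not at hx
      exact ⟨c, by filter_upwards [gt_mem_nhds hx] with t ht using h0 t (le_of_lt ht)⟩
    · push Not at hx
      exact ⟨d, by filter_upwards [lt_mem_nhds hx] with t ht using h1 t (le_of_lt ht)⟩
  have h1 := he.deriv
  refine ⟨by rw [he.deriv_eq]; simp, ?_⟩
  rw [h1.deriv_eq]
  simp

theorem exists_path (k : ℝ) : ∃ c1 c2 c3 : ℝ, ∀ l : ℝ, 0 < l → ∀ g : ℝ, ∃ p : Pth, Conn g p ∧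
    p.J k g = l ^ 3 * c1 + l * c2 + (g - 1) * c3 / l := by
  obtain ⟨a, b, ha, hb, hab, h0, h1⟩ := exists_test
  have ha' := contDiff_infty_iff_deriv.1 ha
  have ha'' := contDiff_infty_iff_deriv.1 ha'.2
  have hb' := contDiff_infty_iff_deriv.1 hb
  have ca := ha.continuous
  have cb := hb.continuous
  have ca1 := ha'.2.continuous
  have ca2 := ha''.2.continuous
  have cb1 := hb'.2.continuous
  have i1 : Integrable fun x => deriv (deriv a) x ^ 2 :=
    cs_int isCompact_Icc (by fun_prop) (fun x hx => by
      rw [(deriv_off (fun x hx => (h0 x hx).1) (fun x hx => (h1 x hx).1) hx).2]; simp)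
  have i2 : Integrable fun x => deriv b x ^ 2 :=
    cs_int isCompact_Icc (by fun_prop) (fun x hx => by
      rw [(deriv_off (fun x hx => (h0 x hx).2) (fun x hx => (h1 x hx).2) hx).1]; simp)
  have i3 : Integrable fun x => a x ^ 2 * b x ^ 2 :=
    cs_int (isCompact_Icc (a := (0:ℝ)) (b := 1)) (by fun_prop) (fun x hx => by
      rw [mem_Icc, not_and_or] at hx
      rcases hx with hx | hx
      · push Not at hx
        simp [(h0 x hx.le).2]
      · push Not at hx
        simp [(h1 x hx.le).1])
  refine ⟨(∫ x, deriv (deriv a) x ^ 2) / 2, k * ∫ x, deriv b x ^ 2,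
    (∫ x, a x ^ 2 * b x ^ 2) / 2, fun l hl g => ?_⟩
  have hdl : ∀ (f : ℝ → ℝ), Differentiable ℝ f → ∀ x,
      HasDerivAt (fun x => f (l * x)) (l * deriv f (l * x)) x := by
    intro f hf x
    have := (hf (l * x)).hasDerivAt.comp x ((hasDerivAt_id x).const_mul l)
    refine this.congr_deriv ?_
    ring
  have hW : ∀ x, Wp g (a (l * x)) (b (l * x)) = (g - 1) / 2 * (a (l * x) ^ 2 * b (l * x) ^ 2) := by
    intro x
    unfold Wp
    rw [hab]
    ring
  have hadm : Adm g ⟨fun x => a (l * x), fun x => l * deriv a (l * x),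
      fun x => l * (l * deriv (deriv a) (l * x)), fun x => b (l * x),
      fun x => l * deriv b (l * x)⟩ := by
    refine ⟨Prim.of_hasDerivAt (by fun_prop) (hdl a ha'.1),
      Prim.smul l (Prim.of_hasDerivAt (by fun_prop) (hdl _ ha''.1)),
      Prim.of_hasDerivAt (by fun_prop) (hdl b hb'.1), ?_, ?_, ?_⟩
    · have := (i1.comp_mul_left' hl.ne').const_mul (l ^ 4)
      refine this.congr (Eventually.of_forall fun x => ?_)
      simp only
      ring
    · have := (i2.comp_mul_left' hl.ne').const_mul (l ^ 2)
      refine this.congr (Eventually.of_forall fun x => ?_)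
      simp only
      ring
    · simp only [hW]
      exact (i3.comp_mul_left' hl.ne').const_mul _
  refine ⟨_, ⟨hadm, ?_, ?_⟩, ?_⟩
  · refine tendsto_const_nhds.congr' ?_
    filter_upwards [eventually_le_atBot 0] with x hx
    have := h0 (l * x) (by nlinarith)
    simp [this]
  · refine tendsto_const_nhds.congr' ?_
    filter_upwards [eventually_ge_atTop (1 / l)] with x hx
    have := h1 (l * x) (by rw [div_le_iff₀ hl] at hx; linarith)
    simp [this]
  · rw [hadm.J_eq k]
    simp only [hW, mul_pow, integral_const_mul]
    rw [Measure.integral_comp_mul_left (fun x => deriv (deriv a) x ^ 2) l,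
      Measure.integral_comp_mul_left (fun x => deriv b x ^ 2) l,
      Measure.integral_comp_mul_left (fun x => a x ^ 2 * b x ^ 2) l]
    simp only [smul_eq_mul, abs_of_pos (inv_pos.2 hl)]
    field_simp

theorem infJ_small {k : ℝ} (hk : 0 < k) {η : ℝ} (hη : 0 < η) : ∃ g0 : ℝ, 1 < g0 ∧
    ∀ g, 1 < g → g < g0 → infJ k g < η := by
  obtain ⟨c1, c2, c3, hc⟩ := exists_path k
  obtain ⟨l, hl, hl2⟩ : ∃ l : ℝ, 0 < l ∧ l ^ 3 * c1 + l * c2 < η / 2 := by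
    have ht : Tendsto (fun l : ℝ => l ^ 3 * c1 + l * c2) (𝓝[>] 0) (𝓝 0) := by
      have : Continuous fun l : ℝ => l ^ 3 * c1 + l * c2 := by fun_prop
      have := this.tendsto 0
      simp only [ne_eq, OfNat.ofNat_ne_zero, not_false_eq_true, zero_pow, zero_mul, add_zero] at this
      exact this.mono_left nhdsWithin_le_nhds
    have h2 := ht.eventually (gt_mem_nhds (half_pos hη))
    obtain ⟨l, h3, h4⟩ := (h2.and self_mem_nhdsWithin).exists
    exact ⟨l, h4, h3⟩
  have ht : Tendsto (fun g : ℝ => (g - 1) * c3 / l) (𝓝 1) (𝓝 0) := by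
    have : Continuous fun g : ℝ => (g - 1) * c3 / l := by fun_prop
    have := this.tendsto 1
    simpa using this
  obtain ⟨r, hr, hr2⟩ := Metric.eventually_nhds_iff.1 (ht.eventually (gt_mem_nhds (half_pos hη)))
  refine ⟨1 + r, by linarith, fun g h1 h2 => ?_⟩
  obtain ⟨p, hp, hJ⟩ := hc l hl g
  have h3 := hr2 (y := g) (by rw [Real.dist_eq, abs_of_pos (by linarith)]; linarith)
  have h4 := infJ_le hk h1.le hp
  linarith

theorem unif_close {k : ℝ} (hk : 0 < k) {δ : ℝ} (hδ : 0 < δ) : ∃ g0 : ℝ, 1 < g0 ∧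
    ∀ g, 1 < g → g < g0 → ∀ q, Conn g q → q.J k g ≤ infJ k g →
      ∀ x, |q.A x ^ 2 + q.B x ^ 2 - 1| < δ := by
  obtain ⟨h, hh, hp⟩ := path_ptwise k 1 hk (fun z => (z.1 ^ 2 + z.2 ^ 2 - 1) ^ 2 / 4)
    (by fun_prop) (δ := δ ^ 2 / 8) (by positivity)
  obtain ⟨g0, hg0, hs⟩ := infJ_small hk (η := min 1 (h * (δ ^ 2 / 8)))
    (lt_min one_pos (by positivity))
  refine ⟨g0, hg0, fun g h1 h2 q H hm x => ?_⟩
  have h3 := hs g h1 h2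
  have h4 : q.J k g ≤ 1 := (hm.trans h3.le).trans (min_le_left _ _)
  have h5 : q.J k g < h * (δ ^ 2 / 8) := (hm.trans_lt h3).trans_le (min_le_right _ _)
  have h6 := hp g h1.le q H.adm h4 x
  have hAc := H.adm.hA.cont
  have hBc := H.adm.hB.cont
  have h7 : ∫ t in x..x+h, (q.A t ^ 2 + q.B t ^ 2 - 1) ^ 2 / 4
      ≤ ∫ t in x..x+h, Wp g (q.A t) (q.B t) := by
    apply intervalIntegral.integral_mono_on (by linarith)
    · apply Continuous.intervalIntegrable
      fun_prop
    · exact H.adm.Wcont.intervalIntegrable _ _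
    · intro t _
      unfold Wp
      have : 0 ≤ g - 1 := by linarith
      have : 0 ≤ (g - 1) / 2 * (q.A t ^ 2 * q.B t ^ 2) := by positivity
      linarith
  have h8 := interval_le_integral H.adm.hW (fun t => Wp_nonneg h1.le _ _) (x := x) (y := x + h)
    (by linarith)
  have h9 := (H.adm.parts_le hk h1.le le_rfl).2.2.1
  simp only at h6
  have h10 : (q.A x ^ 2 + q.B x ^ 2 - 1) ^ 2 / 4 - δ ^ 2 / 8 < δ ^ 2 / 8 := by
    by_contra hc
    push Not at hc
    have := mul_le_mul_of_nonneg_left hc hh.le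
    linarith
  apply abs_lt_of_sq_lt_sq _ hδ.le
  linarith

theorem main_pointwise (ε g : ℝ) : ∃ q : Pth, 0 < ε → 1 < g → Conn g q ∧
    q.J (1 / (2 * ε ^ 2)) g ≤ infJ (1 / (2 * ε ^ 2)) g ∧
    ContDiff ℝ (⊤ : ℕ∞) q.A ∧ ContDiff ℝ (⊤ : ℕ∞) q.B ∧
    (∀ x, iteratedDeriv 4 q.A x = q.A x * (1 - |q.A x| ^ 2 - g * |q.B x| ^ 2)) ∧
    (∀ x, iteratedDeriv 2 q.B x = ε ^ 2 * q.B x * (-1 + g * |q.A x| ^ 2 + |q.B x| ^ 2)) ∧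
    Tendsto (fun x => (q.A x, q.B x)) atBot (𝓝 ((1 : ℝ), (0 : ℝ))) ∧
    Tendsto (fun x => (q.A x, q.B x)) atTop (𝓝 ((0 : ℝ), (1 : ℝ))) ∧ ∀ x, 0 ≤ q.B x := by
  by_cases h : 0 < ε ∧ 1 < g
  · obtain ⟨hε, hg⟩ := h
    have hk : 0 < 1 / (2 * ε ^ 2) := by positivity
    obtain ⟨c1, c2, c3, hc⟩ := exists_path (1 / (2 * ε ^ 2))
    obtain ⟨p, hp, -⟩ := hc 1 one_pos g
    obtain ⟨q, H, hm, t1, t2, t3, t4, hB⟩ := exists_good hk hg ⟨p, hp⟩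
    obtain ⟨U, A3, V, S⟩ := regular hk hg.le H hm
    refine ⟨q, fun _ _ => ⟨H, hm, S.smooth.1, S.smooth.2, fun x => ?_, fun x => ?_,
      t1.prodMk_nhds t2, t3.prodMk_nhds t4, hB⟩⟩
    · rw [sq_abs, sq_abs]
      exact S.eqA x
    · rw [sq_abs, sq_abs, S.eqB x]
      field_simp
      ring
  · exact ⟨⟨0, 0, 0, 0, 0⟩, fun h1 h2 => absurd ⟨h1, h2⟩ h⟩

end Helpers

/-- For any `ε > 0` and `g > 1`, the system
`d⁴A/dx⁴ = A(1−|A|²−g|B|²)`, `d²B/dx² = ε²B(−1+g|A|²+|B|²)` possesses a smooth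
real-valued solution `(A_{ε,g}, B_{ε,g})` with
(1) limits `(1,0)` at `−∞` and `(0,1)` at `+∞`;
(2) `B_{ε,g} ≥ 0`;
(3) for each fixed `ε > 0` the family can be chosen so that
`lim_{g→1⁺} sup_x |A² + B² − 1| = 0`. -/
theorem heteroclinic_for_amplitude_system :
    ∃ A B : ℝ → ℝ → ℝ → ℝ,
      (∀ ε > (0 : ℝ), ∀ g > (1 : ℝ),
        ContDiff ℝ (⊤ : ℕ∞) (A ε g) ∧ ContDiff ℝ (⊤ : ℕ∞) (B ε g) ∧
        (∀ x : ℝ, iteratedDeriv 4 (A ε g) x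
            = A ε g x * (1 - |A ε g x| ^ 2 - g * |B ε g x| ^ 2)) ∧
        (∀ x : ℝ, iteratedDeriv 2 (B ε g) x
            = ε ^ 2 * B ε g x * (-1 + g * |A ε g x| ^ 2 + |B ε g x| ^ 2)) ∧
        Filter.Tendsto (fun x => (A ε g x, B ε g x)) Filter.atBot
          (nhds ((1 : ℝ), (0 : ℝ))) ∧
        Filter.Tendsto (fun x => (A ε g x, B ε g x)) Filter.atTop
          (nhds ((0 : ℝ), (1 : ℝ))) ∧
        (∀ x : ℝ, 0 ≤ B ε g x)) ∧
      (∀ ε > (0 : ℝ), ∀ δ > (0 : ℝ), ∃ g₀ > (1 : ℝ), ∀ g : ℝ, 1 < g → g < g₀ →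
        ∀ x : ℝ, |A ε g x ^ 2 + B ε g x ^ 2 - 1| < δ) := by
  choose q hq using main_pointwise
  refine ⟨fun ε g => (q ε g).A, fun ε g => (q ε g).B, fun ε hε g hg => ?_, fun ε hε δ hδ => ?_⟩
  · exact (hq ε g hε hg).2.2
  · have hk : 0 < 1 / (2 * ε ^ 2) := by
      have : 0 < ε := hε
      positivity
    obtain ⟨g0, hg0, h⟩ := unif_close hk hδ
    exact ⟨g0, hg0, fun g h1 h2 x => h g h1 h2 (q ε g) (hq ε g hε h1).1 (hq ε g hε h1).2.1 x⟩
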